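/- Let α_i be finite Borel partitions of X_i, say α_i = {A_1^i,…,A_{m_i}^i}, let μ ∈ M(X_1,T_1), f ∈ C(X_1,ℝ) and ε > 0. Then there exist open covers U_i = {U_0^i, U_1^i, …, U_{m_i}^i} of X_i with |U_i| = |α_i|+1, such that U_1^i,…,U_{m_i}^i are pairwise disjoint, (τ_{i−1}μ)(U_0^i) < ε and (τ_{i−1}μ)(A_l^i Δ U_l^i) < ε for all 1 ≤ l ≤ m_i and 1 ≤ i ≤ k, and such that P^a(T_1, supp μ, {U_i}_{i=1}^k, f) ≥ Σ_{i=1}^k a_i h_μ(T_1, ⋁_{j=i}^k τ_{j−1}^{−1}α_j) + ∫ f dμ − ε. -/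

import Mathlib

open MeasureTheory Set Filter Topology
open scoped ENNReal symmDiff

namespace WTP

variable {k : ℕ}

/-- cumulative weight `a 1 + … + a i` (zero-indexed: `a 0 + … + a i`). -/
noncomputable def cw (a : Fin k → ℝ) (i : Fin k) : ℝ := ∑ j ∈ Finset.Iic i, a j

/-- Birkhoff sum `S_n f = ∑_{l<n} f ∘ T^l`. -/
noncomputable def birk {X : Type*} (T : X → X) (f : X → ℝ) (n : ℕ) (x : X) : ℝ :=
  ∑ l ∈ Finset.range n, f (T^[l] x)

/-- a (finite) open cover of a topological space. -/
def IsOpenCover {X : Type*} [TopologicalSpace X] (𝒰 : Set (Set X)) : Prop :=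
  𝒰.Finite ∧ (∀ U ∈ 𝒰, IsOpen U) ∧ ⋃₀ 𝒰 = Set.univ

/-- pullback of a cover along a map. -/
def pullCov {X Y : Type*} (g : X → Y) (𝒰 : Set (Set Y)) : Set (Set X) :=
  (fun U => g ⁻¹' U) '' 𝒰

/-- the quantity `exp(−s·n + (1/a₁)·sup_{x∈A} S_{⌈a₁ n⌉} f(x))`, as an element of `ℝ≥0∞`. -/
noncomputable def pterm {X : Type*} (T1 : X → X) (f : X → ℝ) (a1 s : ℝ) (n : ℕ)
    (A : Set X) : ℝ≥0∞ :=
  ENNReal.ofReal (Real.exp (-(s * n) + (1 / a1) * sSup (birk T1 f ⌈a1 * (n : ℝ)⌉₊ '' A)))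

/-- the weighted Bowen ball `B_n^𝐚(x, ε)`. -/
def wBowen {X : Fin k → Type*} [∀ i, MetricSpace (X i)] {X1 : Type*}
    (T : ∀ i, X i → X i) (τ : ∀ i, X1 → X i) (a : Fin k → ℝ)
    (n : ℕ) (x : X1) (ε : ℝ) : Set X1 :=
  {y | ∀ i : Fin k, ∀ j < ⌈cw a i * (n : ℝ)⌉₊,
      dist ((T i)^[j] (τ i x)) ((T i)^[j] (τ i y)) < ε}

section Bowen

variable [NeZero k] {X : Fin k → Type*} [∀ i, MetricSpace (X i)] {X1 : Type*}
  [MeasurableSpace X1]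

/-- `Λ^{𝐚,s}_{N,ε}(Z,f)`. -/
noncomputable def lamBowenN (T1 : X1 → X1) (T : ∀ i, X i → X i) (τ : ∀ i, X1 → X i)
    (a : Fin k → ℝ) (f : X1 → ℝ) (s ε : ℝ) (N : ℕ) (Z : Set X1) : ℝ≥0∞ :=
  ⨅ (D : Set (ℕ × Set X1)) (_ : D.Countable)
    (_ : ∀ p ∈ D, N ≤ p.1 ∧ MeasurableSet p.2 ∧ ∃ x : X1, p.2 ⊆ wBowen T τ a p.1 x ε)
    (_ : Z ⊆ ⋃ p ∈ D, p.2),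
    ∑' p : D, pterm T1 f (a 0) s p.1.1 p.1.2

/-- `Λ^{𝐚,s}_{ε}(Z,f) = lim_{N→∞} Λ^{𝐚,s}_{N,ε}(Z,f)` (an increasing limit). -/
noncomputable def lamBowen (T1 : X1 → X1) (T : ∀ i, X i → X i) (τ : ∀ i, X1 → X i)
    (a : Fin k → ℝ) (f : X1 → ℝ) (s ε : ℝ) (Z : Set X1) : ℝ≥0∞ :=
  ⨆ N : ℕ, lamBowenN T1 T τ a f s ε N Z

/-- `P^𝐚(T₁, Z, ε, f) = inf {s : Λ^{𝐚,s}_ε(Z,f) = 0}`. -/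
noncomputable def PBowenEps (T1 : X1 → X1) (T : ∀ i, X i → X i) (τ : ∀ i, X1 → X i)
    (a : Fin k → ℝ) (Z : Set X1) (f : X1 → ℝ) (ε : ℝ) : EReal :=
  sInf (Real.toEReal '' {s : ℝ | lamBowen T1 T τ a f s ε Z = 0})

/-- the 𝐚-weighted topological pressure `P^𝐚(T₁, Z, f) = lim_{ε→0} P^𝐚(T₁, Z, ε, f)`
(an increasing limit as `ε` decreases to `0`). -/
noncomputable def PBowen (T1 : X1 → X1) (T : ∀ i, X i → X i) (τ : ∀ i, X1 → X i)
    (a : Fin k → ℝ) (Z : Set X1) (f : X1 → ℝ) : EReal :=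
  ⨆ ε : {e : ℝ // 0 < e}, PBowenEps T1 T τ a Z f ε.1

/-- `W^{𝐚,s}_{N,ε}(Z,f)`. -/
noncomputable def wBowenWN (T1 : X1 → X1) (T : ∀ i, X i → X i) (τ : ∀ i, X1 → X i)
    (a : Fin k → ℝ) (f : X1 → ℝ) (s ε : ℝ) (N : ℕ) (Z : Set X1) : ℝ≥0∞ :=
  ⨅ (D : Set (ℕ × Set X1 × ℝ≥0∞)) (_ : D.Countable)
    (_ : ∀ p ∈ D, N ≤ p.1 ∧ MeasurableSet p.2.1 ∧ 0 < p.2.2 ∧ p.2.2 ≠ ⊤ ∧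
        ∃ x : X1, p.2.1 ⊆ wBowen T τ a p.1 x ε)
    (_ : ∀ z ∈ Z, 1 ≤ ∑' p : D, (p.1.2.1).indicator (fun _ => p.1.2.2) z),
    ∑' p : D, p.1.2.2 * pterm T1 f (a 0) s p.1.1 p.1.2.1

/-- `W^{𝐚,s}_{ε}(Z,f)`. -/
noncomputable def wBowenW (T1 : X1 → X1) (T : ∀ i, X i → X i) (τ : ∀ i, X1 → X i)
    (a : Fin k → ℝ) (f : X1 → ℝ) (s ε : ℝ) (Z : Set X1) : ℝ≥0∞ :=
  ⨆ N : ℕ, wBowenWN T1 T τ a f s ε N Z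

/-- `P_W^𝐚(T₁, Z, ε, f)`. -/
noncomputable def PWBowenEps (T1 : X1 → X1) (T : ∀ i, X i → X i) (τ : ∀ i, X1 → X i)
    (a : Fin k → ℝ) (Z : Set X1) (f : X1 → ℝ) (ε : ℝ) : EReal :=
  sInf (Real.toEReal '' {s : ℝ | wBowenW T1 T τ a f s ε Z = 0})

/-- the average 𝐚-weighted topological pressure `P_W^𝐚(T₁, Z, f)`. -/
noncomputable def PWBowen (T1 : X1 → X1) (T : ∀ i, X i → X i) (τ : ∀ i, X1 → X i)
    (a : Fin k → ℝ) (Z : Set X1) (f : X1 → ℝ) : EReal :=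
  ⨆ ε : {e : ℝ // 0 < e}, PWBowenEps T1 T τ a Z f ε.1

end Bowen

section Local

variable [NeZero k] {X1 : Type*} [MeasurableSpace X1]

/-- the cover `⋁_{i=1}^k (τ_{i-1}^{-1} 𝒰_i)_0^{⌈(a_1+…+a_i) n⌉ - 1}` on the first space, where
`𝒱 i` is the pulled back cover `τ_{i-1}^{-1} 𝒰_i`. -/
def jointFiber (T1 : X1 → X1) (a : Fin k → ℝ) (𝒱 : Fin k → Set (Set X1)) (n : ℕ) :
    Set (Set X1) :=
  {A | ∃ V : Fin k → ℕ → Set X1,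
      (∀ i, ∀ l < ⌈cw a i * (n : ℝ)⌉₊, V i l ∈ 𝒱 i) ∧
      A = ⋂ i : Fin k, ⋂ l ∈ Finset.range ⌈cw a i * (n : ℝ)⌉₊, (T1^[l]) ⁻¹' V i l}

/-- `Λ^{𝐚,s}_{N,{𝒰_i}}(Z,f)`. -/
noncomputable def lamLocN (T1 : X1 → X1) (a : Fin k → ℝ) (𝒱 : Fin k → Set (Set X1))
    (f : X1 → ℝ) (s : ℝ) (N : ℕ) (Z : Set X1) : ℝ≥0∞ :=
  ⨅ (D : Set (ℕ × Set X1)) (_ : D.Countable)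
    (_ : ∀ p ∈ D, N ≤ p.1 ∧ MeasurableSet p.2 ∧ ∃ A ∈ jointFiber T1 a 𝒱 p.1, p.2 ⊆ A)
    (_ : Z ⊆ ⋃ p ∈ D, p.2),
    ∑' p : D, pterm T1 f (a 0) s p.1.1 p.1.2

/-- `Λ^{𝐚,s}_{{𝒰_i}}(Z,f)`. -/
noncomputable def lamLoc (T1 : X1 → X1) (a : Fin k → ℝ) (𝒱 : Fin k → Set (Set X1))
    (f : X1 → ℝ) (s : ℝ) (Z : Set X1) : ℝ≥0∞ :=
  ⨆ N : ℕ, lamLocN T1 a 𝒱 f s N Z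

/-- the local 𝐚-weighted topological pressure `P^𝐚(T₁, Z, {𝒰_i}, f)`, expressed through the
pulled-back covers `𝒱 i = τ_{i-1}^{-1} 𝒰_i`. -/
noncomputable def PLoc (T1 : X1 → X1) (a : Fin k → ℝ) (𝒱 : Fin k → Set (Set X1))
    (Z : Set X1) (f : X1 → ℝ) : EReal :=
  sInf (Real.toEReal '' {s : ℝ | lamLoc T1 a 𝒱 f s Z = 0})

/-- `W^{𝐚,s}_{N,{𝒰_i}}(Z,f)`. -/
noncomputable def wLocN (T1 : X1 → X1) (a : Fin k → ℝ) (𝒱 : Fin k → Set (Set X1))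
    (f : X1 → ℝ) (s : ℝ) (N : ℕ) (Z : Set X1) : ℝ≥0∞ :=
  ⨅ (D : Set (ℕ × Set X1 × ℝ≥0∞)) (_ : D.Countable)
    (_ : ∀ p ∈ D, N ≤ p.1 ∧ MeasurableSet p.2.1 ∧ 0 < p.2.2 ∧ p.2.2 ≠ ⊤ ∧
        ∃ A ∈ jointFiber T1 a 𝒱 p.1, p.2.1 ⊆ A)
    (_ : ∀ z ∈ Z, 1 ≤ ∑' p : D, (p.1.2.1).indicator (fun _ => p.1.2.2) z),
    ∑' p : D, p.1.2.2 * pterm T1 f (a 0) s p.1.1 p.1.2.1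

/-- `W^{𝐚,s}_{{𝒰_i}}(Z,f)`. -/
noncomputable def wLoc (T1 : X1 → X1) (a : Fin k → ℝ) (𝒱 : Fin k → Set (Set X1))
    (f : X1 → ℝ) (s : ℝ) (Z : Set X1) : ℝ≥0∞ :=
  ⨆ N : ℕ, wLocN T1 a 𝒱 f s N Z

/-- the local average 𝐚-weighted topological pressure `P_W^𝐚(T₁, Z, {𝒰_i}, f)`. -/
noncomputable def PWLoc (T1 : X1 → X1) (a : Fin k → ℝ) (𝒱 : Fin k → Set (Set X1))
    (Z : Set X1) (f : X1 → ℝ) : EReal :=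
  sInf (Real.toEReal '' {s : ℝ | wLoc T1 a 𝒱 f s Z = 0})

end Local

/-- iterated join `(𝒰)_0^{n-1} = ⋁_{l=0}^{n-1} T^{-l} 𝒰` of a cover. -/
def covJoinT {X : Type*} (T : X → X) (𝒰 : Set (Set X)) (n : ℕ) : Set (Set X) :=
  {A | ∃ u : ℕ → Set X, (∀ l < n, u l ∈ 𝒰) ∧
      A = ⋂ l ∈ Finset.range n, (T^[l]) ⁻¹' u l}

/-- the join `⋁_{j=i}^{k} 𝒱 j` of covers of a single space (in applications
`𝒱 j = τ_{j-1}^{-1} 𝒰_j`). -/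
def joinFrom {X1 : Type*} (𝒱 : Fin k → Set (Set X1)) (i : Fin k) : Set (Set X1) :=
  {A | ∃ V : Fin k → Set X1, (∀ j, i ≤ j → V j ∈ 𝒱 j) ∧ A = ⋂ j ∈ Finset.Ici i, V j}

/-- a finite measurable partition (indexed). -/
def IsPart {X : Type*} [MeasurableSpace X] {ι : Type*} (β : ι → Set X) : Prop :=
  (∀ i, MeasurableSet (β i)) ∧ (∀ i j, i ≠ j → Disjoint (β i) (β j)) ∧ ⋃ i, β i = Set.univ

/-- the static entropy `H_μ(β) = -∑ μ(B) log μ(B)` of a finite (indexed) partition. -/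
noncomputable def entH {X : Type*} [MeasurableSpace X] {ι : Type*} [Fintype ι]
    (μ : Measure X) (β : ι → Set X) : ℝ :=
  ∑ i, Real.negMulLog (μ (β i)).toReal

/-- the dynamical join `⋁_{l=0}^{n-1} T^{-l} β` of a partition. -/
def dynJoin {X : Type*} (T : X → X) {ι : Type*} (β : ι → Set X) (n : ℕ) :
    (Fin n → ι) → Set X :=
  fun c => ⋂ l : Fin n, (T^[(l : ℕ)]) ⁻¹' β (c l)

/-- the measure-theoretic entropy `h_μ(T, β) = lim_n (1/n) H_μ(⋁_{l<n} T^{-l}β)` of `T`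
relative to a finite partition. -/
noncomputable def hPart {X : Type*} [MeasurableSpace X] {ι : Type*} [Fintype ι]
    (μ : Measure X) (T : X → X) (β : ι → Set X) : EReal :=
  Filter.liminf (fun n : ℕ => ((entH μ (dynJoin T β n) / n : ℝ) : EReal)) Filter.atTop

/-- the Kolmogorov–Sinai entropy `h_μ(T)`. -/
noncomputable def hKS {X : Type*} [MeasurableSpace X] (μ : Measure X) (T : X → X) : EReal :=
  ⨆ p : (Σ m : ℕ, {β : Fin m → Set X // IsPart β}), hPart μ T p.2.1

/-- `H_μ(𝒰) = inf {H_μ(β) : β a finite measurable partition refining 𝒰}`. -/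
noncomputable def covH {X : Type*} [MeasurableSpace X] (μ : Measure X)
    (𝒰 : Set (Set X)) : ℝ :=
  sInf {h : ℝ | ∃ (m : ℕ) (β : Fin m → Set X), IsPart β ∧
      (∀ i, ∃ U ∈ 𝒰, β i ⊆ U) ∧ h = entH μ β}

/-- the local measure-theoretic entropy `h_μ(T, 𝒰) = lim_n (1/n) H_μ((𝒰)_0^{n-1})` of `T`
relative to an open cover. -/
noncomputable def hCov {X : Type*} [MeasurableSpace X] (μ : Measure X) (T : X → X)
    (𝒰 : Set (Set X)) : EReal :=
  Filter.liminf (fun n : ℕ => ((covH μ (covJoinT T 𝒰 n) / n : ℝ) : EReal)) Filter.atTop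

/-- `h⁺_μ(T,𝒰) = inf {h_μ(T,β) : β a finite measurable partition refining 𝒰}`. -/
noncomputable def hCovPlus {X : Type*} [MeasurableSpace X] (μ : Measure X) (T : X → X)
    (𝒰 : Set (Set X)) : EReal :=
  ⨅ p : (Σ m : ℕ, {β : Fin m → Set X // IsPart β ∧ ∀ i, ∃ U ∈ 𝒰, β i ⊆ U}),
    hPart μ T p.2.1

/-- the join `⋁_{j=i}^{k} γ j` of partitions of a single space (in applications
`γ j = τ_{j-1}^{-1} α_j`). -/
def partJoinFrom {X1 : Type*} {ι : Fin k → Type*} (γ : ∀ j, ι j → Set X1) (i : Fin k) :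
    (∀ j : {j : Fin k // i ≤ j}, ι j) → Set X1 :=
  fun c => ⋂ j : {j : Fin k // i ≤ j}, γ j (c j)

/-- the partition `⋁_{i=1}^k (γ_i)_0^{⌈(a_1+…+a_i)N⌉-1}` on the first space, where
`γ i = τ_{i-1}^{-1} α_i`. -/
def bigPartJoin {X1 : Type*} (T1 : X1 → X1) (a : Fin k → ℝ) {ι : Fin k → Type*}
    (γ : ∀ i, ι i → Set X1) (N : ℕ) :
    (∀ i : Fin k, Fin ⌈cw a i * (N : ℝ)⌉₊ → ι i) → Set X1 :=
  fun c => ⋂ i : Fin k, ⋂ l : Fin ⌈cw a i * (N : ℝ)⌉₊, (T1^[(l : ℕ)]) ⁻¹' γ i (c i l)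

/-- conditional entropy `H_μ(γ|β) = H_μ(γ ∨ β) - H_μ(β)`. -/
noncomputable def condEnt {X : Type*} [MeasurableSpace X] {ι κ : Type*} [Fintype ι] [Fintype κ]
    (μ : Measure X) (γ : ι → Set X) (β : κ → Set X) : ℝ :=
  entH μ (fun p : ι × κ => γ p.1 ∩ β p.2) - entH μ β

/-- the oscillation `w_f(⋁_{i=1}^k τ_{i-1}^{-1} 𝒰_i)` of `f` on the joined cover, where
`𝒱 i = τ_{i-1}^{-1} 𝒰_i`. -/
noncomputable def wfJoin {X1 : Type*} (f : X1 → ℝ) (𝒱 : Fin k → Set (Set X1)) : ℝ :=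
  sSup {d : ℝ | ∃ V : Fin k → Set X1, (∀ i, V i ∈ 𝒱 i) ∧
      ∃ x ∈ ⋂ i, V i, ∃ y ∈ ⋂ i, V i, d = |f x - f y|}

/-- the topological support of a measure. -/
def msupp {X : Type*} [TopologicalSpace X] [MeasurableSpace X] (μ : Measure X) : Set X :=
  {x | ∀ U : Set X, IsOpen U → x ∈ U → 0 < μ U}


/-- Along an orbit, short blocks on which the Birkhoff sums of `φ` are small tile the orbit, up to
the bad set `B` (where `φ` is replaced by `0`) and up to one incomplete block. -/
lemma birkhoffSum_indicator_le {X : Type*} {T : X → X} {φ L : X → ℝ} {M e : ℝ} (he : 0 ≤ e)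
    (h0 : ∀ x, 0 ≤ φ x) (hM : ∀ x, φ x ≤ M) (hL0 : ∀ x, 0 ≤ L x) (hLT : ∀ x, L (T x) ≤ L x)
    {B : Set X} {N : ℕ}
    (hB : ∀ x ∉ B, ∃ p, 1 ≤ p ∧ p ≤ N ∧ birkhoffSum T φ p x ≤ p * (L x + e)) (n : ℕ) (x : X) :
    birkhoffSum T (Bᶜ.indicator φ) n x ≤ n * (L x + e) + N * M := by
  have hle : ∀ y, Bᶜ.indicator φ y ≤ φ y := fun y => indicator_le_self' (fun _ _ => h0 _) y
  have hM0 : 0 ≤ M := (h0 x).trans (hM x)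
  have hLit : ∀ p y, L (T^[p] y) ≤ L y := by
    intro p
    induction p with
    | zero => intro y; simp
    | succ p ih => intro y; rw [Function.iterate_succ_apply]; exact (ih _).trans (hLT y)
  induction n using Nat.strong_induction_on generalizing x with
  | _ n ih =>
    by_cases hn : n ≤ N
    · have h1 : birkhoffSum T (Bᶜ.indicator φ) n x ≤ n * M := by
        have := Finset.sum_le_card_nsmul (Finset.range n)
          (fun l => Bᶜ.indicator φ (T^[l] x)) M (fun l _ => (hle _).trans (hM _))
        simpa [birkhoffSum] using this
      have h2 : (n : ℝ) * M ≤ N * M := by gcongr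
      have h3 : 0 ≤ n * (L x + e) := by have := hL0 x; positivity
      linarith
    · push Not at hn
      by_cases hx : x ∈ B
      · obtain ⟨n, rfl⟩ : ∃ q, n = q + 1 := ⟨n - 1, by omega⟩
        rw [birkhoffSum_succ', indicator_of_notMem (by simpa using hx), zero_add]
        refine (ih n (by omega) (T x)).trans ?_
        have := hLT x
        have := hL0 x
        push_cast
        nlinarith [mul_le_mul_of_nonneg_left (hLT x) (Nat.cast_nonneg (α := ℝ) n)]
      · obtain ⟨p, hp1, hpN, hp⟩ := hB x hx
        obtain ⟨q, rfl⟩ : ∃ q, n = p + q := ⟨n - p, by omega⟩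
        rw [birkhoffSum_add]
        have h1 := ih q (by omega) (T^[p] x)
        have h2 : birkhoffSum T (Bᶜ.indicator φ) p x ≤ birkhoffSum T φ p x :=
          Finset.sum_le_sum fun l _ => hle _
        push_cast
        nlinarith [mul_le_mul_of_nonneg_left (hLit p x) (Nat.cast_nonneg (α := ℝ) q)]

/-- The half of the pointwise ergodic theorem that bounds lower limits of Birkhoff averages from
below, for nonnegative bounded functions. -/
lemma exists_lower_birkhoff_of_nonneg {X : Type*} [MeasurableSpace X] {μ : Measure X}
    [IsProbabilityMeasure μ] {T : X → X} (hT : MeasurePreserving T μ μ) {φ : X → ℝ}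
    (hφ : Measurable φ) {M : ℝ} (h0 : ∀ x, 0 ≤ φ x) (hM : ∀ x, φ x ≤ M) :
    ∃ L : X → ℝ, Measurable L ∧ (∀ x, 0 ≤ L x ∧ L x ≤ M) ∧ ∫ x, φ x ∂μ ≤ ∫ x, L x ∂μ ∧
      ∀ x, ∀ e > 0, ∀ᶠ n : ℕ in atTop, n * (L x - e) ≤ birkhoffSum T φ n x := by
  set A : ℕ → X → ℝ := fun n x => birkhoffSum T φ n x / n with hA
  have hS0 : ∀ n x, 0 ≤ birkhoffSum T φ n x := fun n x => Finset.sum_nonneg fun _ _ => h0 _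
  have hSM : ∀ n x, birkhoffSum T φ n x ≤ n * M := by
    intro n x
    have := Finset.sum_le_card_nsmul (Finset.range n) (fun l => φ (T^[l] x)) M (fun l _ => hM _)
    simpa [birkhoffSum] using this
  have hSm : ∀ n, Measurable (birkhoffSum T φ n) := fun n => by
    unfold birkhoffSum
    exact Finset.measurable_sum _ fun l _ => hφ.comp (hT.measurable.iterate l)
  have hA0 : ∀ n x, 0 ≤ A n x := fun n x => div_nonneg (hS0 n x) (Nat.cast_nonneg n)
  have hM0 : ∀ x : X, 0 ≤ M := fun x => (h0 x).trans (hM x)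
  have hAM : ∀ n x, A n x ≤ M := fun n x =>
    div_le_of_le_mul₀ (Nat.cast_nonneg n) (hM0 x) (by rw [mul_comm]; exact hSM n x)
  have hbb : ∀ x, IsBoundedUnder (· ≥ ·) atTop fun n => A n x :=
    fun x => isBoundedUnder_of ⟨0, fun n => hA0 n x⟩
  have hba : ∀ x, IsBoundedUnder (· ≤ ·) atTop fun n => A n x :=
    fun x => isBoundedUnder_of ⟨M, fun n => hAM n x⟩
  have hco : ∀ x, IsCoboundedUnder (· ≥ ·) atTop fun n => A n x :=
    fun x => (hba x).isCoboundedUnder_ge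
  set L : X → ℝ := fun x => liminf (fun n => A n x) atTop with hL
  have hLm : Measurable L := Measurable.liminf fun n => (hSm n).div_const _
  have hL0 : ∀ x, 0 ≤ L x := fun x =>
    le_liminf_of_le (hco x) (Eventually.of_forall fun n => hA0 n x)
  have hLM : ∀ x, L x ≤ M := fun x =>
    liminf_le_of_le (hbb x) fun b hb => by
      obtain ⟨n, hn⟩ := hb.exists
      exact hn.trans (hAM n x)
  have hLev : ∀ x c, c < L x → ∀ᶠ n in atTop, c < A n x := fun x c hc =>
    eventually_lt_of_lt_liminf hc (hbb x)
  have hlow : ∀ x, ∀ e > 0, ∀ᶠ n : ℕ in atTop, n * (L x - e) ≤ birkhoffSum T φ n x := by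
    intro x e he
    filter_upwards [hLev x (L x - e) (by linarith), eventually_gt_atTop 0] with n hn hn0
    have : (0 : ℝ) < n := by exact_mod_cast hn0
    rw [hA, lt_div_iff₀ this] at hn
    linarith
  have hLT : ∀ x, L (T x) ≤ L x := by
    intro x
    refine le_of_forall_pos_le_add fun e he => ?_
    have h1 : ∀ᶠ n in atTop, L (T x) - e ≤ A n x := by
      have ht : Tendsto (fun n : ℕ => M / (n : ℝ)) atTop (𝓝 0) :=
        tendsto_const_div_atTop_nhds_zero_nat M
      have h2 := (hLev (T x) (L (T x) - e / 2) (by linarith)).and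
        ((ht.eventually (gt_mem_nhds (show (0 : ℝ) < e / 2 by linarith))).and
          (eventually_gt_atTop 0))
      rw [← map_add_atTop_eq_nat 1, eventually_map]
      filter_upwards [h2] with n ⟨ha, hb, hn0⟩
      have hn : (0 : ℝ) < n := by exact_mod_cast hn0
      have h3 : birkhoffSum T φ n (T x) ≤ birkhoffSum T φ (n + 1) x := by
        rw [birkhoffSum_succ']; linarith [h0 x]
      have h4 := hSM (n + 1) x
      simp only [hA] at ha ⊢
      rw [lt_div_iff₀ hn] at ha
      rw [div_lt_iff₀ hn] at hb
      rw [le_div_iff₀ (by push_cast; linarith)]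
      push_cast at h4 ⊢
      have h5 : L (T x) ≤ M := hLM (T x)
      nlinarith
    have := le_liminf_of_le (hco x) h1
    linarith
  refine ⟨L, hLm, fun x => ⟨hL0 x, hLM x⟩, ?_, hlow⟩
  obtain ⟨x0⟩ : Nonempty X := by
    by_contra h
    rw [not_nonempty_iff] at h
    have := measure_univ (μ := μ)
    simp [univ_eq_empty_iff.2 h] at this
  have hM' := hM0 x0
  have hint : ∀ g : X → ℝ, Measurable g → (∀ x, 0 ≤ g x) → (∀ x, g x ≤ M) → Integrable g μ :=
    fun g hg h1 h2 => Integrable.of_bound hg.aestronglyMeasurable M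
      (Eventually.of_forall fun x => by rw [Real.norm_of_nonneg (h1 x)]; exact h2 x)
  have hLi := hint L hLm hL0 hLM
  have hφi := hint φ hφ h0 hM
  refine le_of_forall_pos_le_add fun e he => ?_
  set B : ℕ → Set X := fun N => {x | ∀ p, 1 ≤ p → p ≤ N → p * (L x + e / 2) < birkhoffSum T φ p x}
    with hBdef
  have hBm : ∀ N, MeasurableSet (B N) := by
    intro N
    have : B N = ⋂ p, ⋂ (_ : 1 ≤ p), ⋂ (_ : p ≤ N),
        {x | p * (L x + e / 2) < birkhoffSum T φ p x} := by ext x; simp [hBdef]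
    rw [this]
    exact MeasurableSet.iInter fun p => MeasurableSet.iInter fun _ => MeasurableSet.iInter fun _ =>
      measurableSet_lt ((hLm.add_const _).const_mul _) (hSm p)
  have hBanti : Antitone B := fun N N' h x hx p h1 h2 => hx p h1 (h2.trans h)
  have hBempty : ⋂ N, B N = ∅ := by
    refine eq_empty_of_forall_notMem fun x hx => ?_
    have hf : ∃ᶠ n in atTop, A n x < L x + e / 2 :=
      frequently_lt_of_liminf_lt (hco x) (show L x < L x + e / 2 by linarith)
    obtain ⟨n, hn1, hn⟩ := (hf.and_eventually (eventually_gt_atTop 0)).exists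
    have hn0 : (0 : ℝ) < n := by exact_mod_cast hn
    have := mem_iInter.1 hx n n hn le_rfl
    rw [hA] at hn1
    simp only [div_lt_iff₀ hn0] at hn1
    linarith
  have hBt : Tendsto (fun N => μ.real (B N) * M) atTop (𝓝 0) := by
    have h1 := tendsto_measure_iInter_atTop (μ := μ) (fun N => (hBm N).nullMeasurableSet) hBanti
      ⟨0, measure_ne_top _ _⟩
    rw [hBempty, measure_empty] at h1
    have h2 := (ENNReal.tendsto_toReal ENNReal.zero_ne_top).comp h1
    have h3 := h2.mul_const M
    rw [ENNReal.toReal_zero, zero_mul] at h3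
    exact h3
  obtain ⟨N, hN⟩ := (hBt.eventually (gt_mem_nhds (show (0 : ℝ) < e / 2 by linarith))).exists
  set ψ := (B N)ᶜ.indicator φ with hψ
  have hψm : Measurable ψ := hφ.indicator (hBm N).compl
  have hψi : Integrable ψ μ := hφi.indicator (hBm N).compl
  have hψT : ∀ l, Integrable (fun x => ψ (T^[l] x)) μ := fun l =>
    (hT.iterate l).integrable_comp_of_integrable hψi
  have hkey : ∀ n : ℕ, n * ∫ x, ψ x ∂μ ≤ n * (∫ x, L x ∂μ + e / 2) + N * M := by
    intro n
    have h1 : ∫ x, birkhoffSum T ψ n x ∂μ = n * ∫ x, ψ x ∂μ := by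
      simp only [birkhoffSum]
      have hcomp : ∀ l, ∫ x, ψ (T^[l] x) ∂μ = ∫ x, ψ x ∂μ := fun l => by
        rw [← integral_map (hT.iterate l).measurable.aemeasurable
          (by rw [(hT.iterate l).map_eq]; exact hψm.aestronglyMeasurable), (hT.iterate l).map_eq]
      rw [integral_finsetSum _ fun l _ => hψT l]
      simp [hcomp]
    rw [← h1]
    have h2 : ∫ x, (n * (L x + e / 2) + N * M) ∂μ = n * (∫ x, L x ∂μ + e / 2) + N * M := by
      have h3 : Integrable (fun x => L x + e / 2) μ := hLi.add (integrable_const _)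
      rw [integral_add (h3.const_mul _) (integrable_const _),
        integral_const_mul, integral_add hLi (integrable_const _)]
      simp
    rw [← h2]
    refine integral_mono ?_ (((hLi.add (integrable_const _)).const_mul _).add (integrable_const _))
      fun x => birkhoffSum_indicator_le (by linarith) h0 hM hL0 hLT ?_ n x
    · exact integrable_finsetSum _ fun l _ => hψT l
    · intro y hy
      simp only [hBdef, mem_ofPred_eq, not_forall, not_lt] at hy
      obtain ⟨p, h1, h2, h3⟩ := hy
      exact ⟨p, h1, h2, h3⟩
  have hψle : ∫ x, ψ x ∂μ ≤ ∫ x, L x ∂μ + e / 2 := by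
    refine le_of_tendsto_of_tendsto (tendsto_const_nhds (x := ∫ x, ψ x ∂μ))
      (b := atTop) (g := fun n : ℕ => (∫ x, L x ∂μ + e / 2) + (N * M) / n) ?_ ?_
    · simpa using (tendsto_const_nhds (x := ∫ x, L x ∂μ + e / 2)).add
        (tendsto_const_div_atTop_nhds_zero_nat ((N : ℝ) * M))
    · filter_upwards [eventually_gt_atTop 0] with n hn
      have hn0 : (0 : ℝ) < n := by exact_mod_cast hn
      have := hkey n
      rw [← mul_le_mul_iff_right₀ hn0]
      calc _ ≤ _ := this
        _ = _ := by field_simp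
  have hφψ : ∫ x, φ x ∂μ ≤ ∫ x, ψ x ∂μ + μ.real (B N) * M := by
    have h1 : ∫ x, (B N).indicator (fun _ => M) x ∂μ = μ.real (B N) * M := by
      rw [integral_indicator_const _ (hBm N), smul_eq_mul]
    rw [← h1, ← integral_add hψi ((integrable_const M).indicator (hBm N))]
    refine integral_mono hφi (hψi.add ((integrable_const M).indicator (hBm N))) fun x => ?_
    by_cases hx : x ∈ B N <;> simp [hψ, hx, hM x]
  linarith

/-- The half of the pointwise ergodic theorem that bounds lower limits of Birkhoff averages from
below, for bounded functions. -/
lemma exists_lower_birkhoff {X : Type*} [MeasurableSpace X] {μ : Measure X}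
    [IsProbabilityMeasure μ] {T : X → X} (hT : MeasurePreserving T μ μ) {φ : X → ℝ}
    (hφ : Measurable φ) {M : ℝ} (hM : ∀ x, |φ x| ≤ M) :
    ∃ L : X → ℝ, Measurable L ∧ (∀ x, |L x| ≤ M) ∧ ∫ x, φ x ∂μ ≤ ∫ x, L x ∂μ ∧
      ∀ x, ∀ e > 0, ∀ᶠ n : ℕ in atTop, n * (L x - e) ≤ birkhoffSum T φ n x := by
  obtain ⟨L, hLm, hLb, hLi, hL⟩ := exists_lower_birkhoff_of_nonneg hT (φ := fun x => φ x + M)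
    (hφ.add_const M) (M := 2 * M) (fun x => by linarith [neg_abs_le (φ x), hM x])
    (fun x => by linarith [le_abs_self (φ x), hM x])
  refine ⟨fun x => L x - M, hLm.sub_const M, fun x => ?_, ?_, fun x e he => ?_⟩
  · rw [abs_le]; constructor <;> linarith [(hLb x).1, (hLb x).2]
  · have hφi : Integrable φ μ := Integrable.of_bound hφ.aestronglyMeasurable M
      (Eventually.of_forall hM)
    have hLi' : Integrable L μ := Integrable.of_bound hLm.aestronglyMeasurable (2 * M)
      (Eventually.of_forall fun x => by rw [Real.norm_of_nonneg (hLb x).1]; exact (hLb x).2)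
    rw [integral_add hφi (integrable_const _)] at hLi
    rw [integral_sub hLi' (integrable_const _)]
    linarith
  · filter_upwards [hL x e he] with n hn
    have : birkhoffSum T (fun x => φ x + M) n x = birkhoffSum T φ n x + n * M := by
      simp [birkhoffSum, Finset.sum_add_distrib]
    rw [this] at hn
    linarith

/-- On a set of positive measure, weighted sums of Birkhoff sums over windows of different speeds
eventually almost exceed their mean. -/
lemma exists_pos_measure_birkhoffSum_ge {X ι : Type*} [Fintype ι] [MeasurableSpace X]
    {μ : Measure X} [IsProbabilityMeasure μ] {T : X → X} (hT : MeasurePreserving T μ μ)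
    {φ : ι → X → ℝ} (hφ : ∀ i, Measurable (φ i)) {M : ι → ℝ} (hM : ∀ i x, |φ i x| ≤ M i)
    {c : ι → ℝ} (hc : ∀ i, 0 < c i) {η : ℝ} (hη : 0 < η) :
    ∃ (N : ℕ) (G : Set X), 0 < μ G ∧ ∀ x ∈ G, ∀ n : ℕ, N ≤ n →
      n * (∑ i, c i * ∫ x, φ i x ∂μ - η) ≤ ∑ i, birkhoffSum T (φ i) ⌈c i * (n : ℝ)⌉₊ x := by
  choose L hLm hLb hLi hL using fun i => exists_lower_birkhoff hT (hφ i) (hM i)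
  have hLint : ∀ i, Integrable (L i) μ := fun i =>
    Integrable.of_bound (hLm i).aestronglyMeasurable (M i) (Eventually.of_forall (hLb i))
  have hFint : Integrable (fun x => ∑ i, c i * L i x) μ :=
    integrable_finsetSum _ fun i _ => (hLint i).const_mul _
  have hFle : ∑ i, c i * ∫ x, φ i x ∂μ ≤ ∫ x, ∑ i, c i * L i x ∂μ := by
    rw [integral_finsetSum _ fun i _ => (hLint i).const_mul _]
    refine Finset.sum_le_sum fun i _ => ?_
    rw [integral_const_mul]
    exact mul_le_mul_of_nonneg_left (hLi i) (hc i).le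
  have hev : ∀ x, ∀ᶠ n : ℕ in atTop,
      n * (∑ i, c i * L i x - η) ≤ ∑ i, birkhoffSum T (φ i) ⌈c i * (n : ℝ)⌉₊ x := by
    intro x
    set C := ∑ i, c i with hC
    have hC0 : 0 ≤ C := Finset.sum_nonneg fun i _ => (hc i).le
    set e := η / (2 * (C + 1)) with he
    have he0 : 0 < e := by positivity
    have hce : C * e ≤ η / 2 := by
      rw [he, mul_div_assoc', div_le_div_iff₀ (by positivity) (by positivity)]
      nlinarith
    have h1 : ∀ᶠ n : ℕ in atTop, ∀ i, (⌈c i * (n : ℝ)⌉₊ : ℝ) * (L i x - e) ≤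
        birkhoffSum T (φ i) ⌈c i * (n : ℝ)⌉₊ x := by
      rw [eventually_all]
      intro i
      have ht : Tendsto (fun n : ℕ => ⌈c i * (n : ℝ)⌉₊) atTop atTop :=
        tendsto_nat_ceil_atTop.comp (tendsto_natCast_atTop_atTop.const_mul_atTop (hc i))
      exact ht.eventually (hL i x e he0)
    have h2 : ∀ᶠ n : ℕ in atTop, ∑ i, (M i + e) ≤ n * (η / 2) :=
      (tendsto_natCast_atTop_atTop.atTop_mul_const (by linarith)).eventually_ge_atTop _
    filter_upwards [h1, h2] with n hn1 hn2
    have h3 : ∀ i, n * (c i * L i x) - n * (c i * e) - (M i + e) ≤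
        birkhoffSum T (φ i) ⌈c i * (n : ℝ)⌉₊ x := by
      intro i
      refine le_trans ?_ (hn1 i)
      have ha := Nat.le_ceil (c i * (n : ℝ))
      have hb := Nat.ceil_lt_add_one (a := c i * (n : ℝ)) (mul_nonneg (hc i).le (by positivity))
      have hd := abs_le.1 (hLb i x)
      nlinarith
    refine le_trans ?_ (Finset.sum_le_sum fun i _ => h3 i)
    rw [Finset.sum_sub_distrib, Finset.sum_sub_distrib, ← Finset.mul_sum, ← Finset.mul_sum,
      ← Finset.sum_mul]
    have : (n : ℝ) * (C * e) ≤ n * (η / 2) := by gcongr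
    linarith
  set G : ℕ → Set X := fun N => {x | ∀ n : ℕ, N ≤ n →
    n * (∑ i, c i * ∫ x, φ i x ∂μ - η) ≤ ∑ i, birkhoffSum T (φ i) ⌈c i * (n : ℝ)⌉₊ x} with hG
  have hpos : 0 < μ {x | ∫ x, ∑ i, c i * L i x ∂μ ≤ ∑ i, c i * L i x} :=
    measure_integral_le_pos hFint
  have hsub : {x | ∫ x, ∑ i, c i * L i x ∂μ ≤ ∑ i, c i * L i x} ⊆ ⋃ N, G N := by
    intro x hx
    obtain ⟨N, hN⟩ := eventually_atTop.1 (hev x)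
    refine mem_iUnion.2 ⟨N, fun n hn => le_trans ?_ (hN n hn)⟩
    have : ∑ i, c i * ∫ x, φ i x ∂μ ≤ ∑ i, c i * L i x := hFle.trans hx
    gcongr
  by_contra hcon
  push Not at hcon
  have hzero : ∀ N, μ (G N) = 0 := by
    intro N
    by_contra h
    obtain ⟨x, hx, n, hn, hlt⟩ := hcon N (G N) (pos_iff_ne_zero.2 h)
    exact absurd (hx n hn) (not_le.2 hlt)
  exact absurd (measure_mono_null hsub (measure_iUnion_null hzero)) hpos.ne'

/-- The itinerary `(β x, β (T x), …, β (T^(n-1) x))` of a point with respect to a coding `β`. -/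
def itin {X J : Type*} (T : X → X) (β : X → J) (n : ℕ) (x : X) : Fin n → J :=
  fun l => β (T^[l] x)

/-- The σ-algebra generated by the full itinerary. -/
@[reducible] def itinAlg {X J : Type*} (T : X → X) (β : X → J) : MeasurableSpace X :=
  ⨆ n, MeasurableSpace.comap (itin T β n) ⊤

/-- The σ-algebra generated by the itinerary from time one on. -/
@[reducible] def futAlg {X J : Type*} (T : X → X) (β : X → J) : MeasurableSpace X :=
  MeasurableSpace.comap T (itinAlg T β)

section Itin

variable {X J : Type*} {T : X → X} {β : X → J}

lemma comap_comp_top_le {Y Z W : Type*} (g : Z → W) (h : Y → Z) :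
    MeasurableSpace.comap (g ∘ h) ⊤ ≤ MeasurableSpace.comap h ⊤ := by
  rw [← MeasurableSpace.comap_comp]
  exact MeasurableSpace.comap_mono le_top

lemma itin_comp_eq_tail (n : ℕ) : itin T β n ∘ T = (fun c : Fin (n + 1) → J => c ∘ Fin.succ) ∘
    itin T β (n + 1) := by
  ext x l
  simp [itin]

lemma futAlg_eq : futAlg T β = ⨆ n, MeasurableSpace.comap (itin T β n ∘ T) ⊤ := by
  simp [futAlg, itinAlg, MeasurableSpace.comap_iSup, MeasurableSpace.comap_comp]

lemma futAlg_le_itinAlg : futAlg T β ≤ itinAlg T β := by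
  rw [futAlg_eq]
  refine iSup_le fun n => ?_
  rw [itin_comp_eq_tail]
  exact (comap_comp_top_le _ _).trans (le_iSup (fun n => MeasurableSpace.comap (itin T β n) ⊤) _)

lemma comap_le_itinAlg : MeasurableSpace.comap β ⊤ ≤ itinAlg T β := by
  have : β = (fun c : Fin 1 → J => c 0) ∘ itin T β 1 := by ext x; simp [itin]
  calc MeasurableSpace.comap β ⊤ ≤ MeasurableSpace.comap (itin T β 1) ⊤ := by
        conv_lhs => rw [this]
        exact comap_comp_top_le _ _
    _ ≤ _ := le_iSup (fun n => MeasurableSpace.comap (itin T β n) ⊤) _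

lemma itinAlg_comp_le {J' : Type*} (g : J → J') : itinAlg T (g ∘ β) ≤ itinAlg T β := by
  refine iSup_mono fun n => ?_
  have : itin T (g ∘ β) n = (fun c : Fin n → J => g ∘ c) ∘ itin T β n := rfl
  rw [this]
  exact comap_comp_top_le _ _

lemma measurable_futAlg_itinAlg : Measurable[futAlg T β, itinAlg T β] T :=
  Measurable.of_comap_le le_rfl

lemma measurable_itinAlg_iterate (l : ℕ) : Measurable[itinAlg T β, itinAlg T β] T^[l] := by
  let := itinAlg T β
  exact Measurable.iterate (measurable_futAlg_itinAlg.mono futAlg_le_itinAlg le_rfl) l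

lemma dynJoin_fiber_eq (n : ℕ) (c : Fin n → J) :
    dynJoin T (fun t => β ⁻¹' {t}) n c = itin T β n ⁻¹' {c} := by
  ext x
  simp [dynJoin, itin, funext_iff]

variable [MeasurableSpace X] [Fintype J]

lemma measurable_itin (hT : Measurable T) (hβ : Measurable[_, ⊤] β) (n : ℕ) :
    Measurable[_, ⊤] (itin T β n) := by
  let : MeasurableSpace J := ⊤
  let : MeasurableSpace (Fin n → J) := ⊤
  refine measurable_to_countable' fun c => ?_
  rw [← dynJoin_fiber_eq]
  exact MeasurableSet.iInter fun l => (hβ.comp (hT.iterate l)) (by trivial)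

lemma itinAlg_le (hT : Measurable T) (hβ : Measurable[_, ⊤] β) : itinAlg T β ≤ ‹_› :=
  iSup_le fun n => (measurable_itin hT hβ n).comap_le

lemma futAlg_le (hT : Measurable T) (hβ : Measurable[_, ⊤] β) : futAlg T β ≤ ‹_› :=
  futAlg_le_itinAlg.trans (itinAlg_le hT hβ)

end Itin

/-- Integral of a function of a finite-valued random variable. -/
lemma integral_comp_fintype {X K : Type*} [MeasurableSpace X] [Fintype K] {ν : Measure X}
    [IsFiniteMeasure ν] {Y : X → K} (hY : Measurable[_, ⊤] Y) (h : K → ℝ) :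
    ∫ x, h (Y x) ∂ν = ∑ y, ν.real (Y ⁻¹' {y}) * h y := by
  let : MeasurableSpace K := ⊤
  have hY' : Measurable Y := hY
  have : DiscreteMeasurableSpace K := ⟨fun _ => trivial⟩
  rw [← integral_map (f := h) hY'.aemeasurable (measurable_of_finite h).aestronglyMeasurable,
    integral_fintype .of_finite]
  simp only [smul_eq_mul]
  refine Finset.sum_congr rfl fun y _ => ?_
  rw [map_measureReal_apply hY' (measurableSet_singleton y)]

/-- Conditional probability given a finite-valued random variable. -/
lemma condExp_indicator_comap_ae_eq {X K : Type*} {mX : MeasurableSpace X} [Fintype K]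
    {μ : Measure X} [IsProbabilityMeasure μ] {Y : X → K} (hY : Measurable[_, ⊤] Y) {E : Set X}
    (hE : MeasurableSet E) :
    (fun x => μ.real (E ∩ Y ⁻¹' {Y x}) / μ.real (Y ⁻¹' {Y x})) =ᵐ[μ]
      μ[E.indicator 1 | MeasurableSpace.comap Y ⊤] := by
  have hle : MeasurableSpace.comap Y ⊤ ≤ mX := hY.comap_le
  set h : K → ℝ := fun y => μ.real (E ∩ Y ⁻¹' {y}) / μ.real (Y ⁻¹' {y}) with hh
  have hYS : ∀ S : Set K, MeasurableSet (Y ⁻¹' S) := fun S => hY trivial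
  have hmeas : Measurable[MeasurableSpace.comap Y ⊤] fun x => h (Y x) := by
    let : MeasurableSpace K := ⊤
    exact (measurable_from_top (f := h)).comp (comap_measurable Y)
  have hint : Integrable (fun x => h (Y x)) μ := by
    refine Integrable.of_bound (hmeas.mono hle le_rfl).aestronglyMeasurable 1
      (Eventually.of_forall fun x => ?_)
    rw [Real.norm_of_nonneg (by positivity)]
    exact div_le_one_of_le₀ (measureReal_mono inter_subset_right) (by positivity)
  refine ae_eq_condExp_of_forall_setIntegral_eq hle
    ((integrable_const (1 : ℝ)).indicator hE) (fun s _ _ => hint.integrableOn) ?_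
    hmeas.stronglyMeasurable.aestronglyMeasurable
  rintro _ ⟨S, -, rfl⟩ -
  classical
  have h1 : ∫ x in Y ⁻¹' S, h (Y x) ∂μ = ∫ x, (S.indicator h) (Y x) ∂μ := by
    rw [← integral_indicator (hYS S)]
    rfl
  have h2 : ∫ x in Y ⁻¹' S, E.indicator (1 : X → ℝ) x ∂μ =
      ∫ x, (S.indicator (1 : K → ℝ)) (Y x) ∂(μ.restrict E) := by
    rw [setIntegral_indicator hE, inter_comm]
    have : (fun x => (S.indicator (1 : K → ℝ)) (Y x)) = (Y ⁻¹' S).indicator 1 := rfl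
    rw [this, integral_indicator (hYS S), Measure.restrict_restrict (hYS S), inter_comm]
  rw [h1, h2, integral_comp_fintype hY, integral_comp_fintype hY]
  refine Finset.sum_congr rfl fun y _ => ?_
  by_cases hy : y ∈ S
  · have h3 : (μ.restrict E).real (Y ⁻¹' {y}) = μ.real (E ∩ Y ⁻¹' {y}) := by
      rw [measureReal_restrict_apply (hYS _), inter_comm]
    simp only [indicator_of_mem hy, h3, hh, Pi.one_apply, mul_one]
    by_cases h0 : μ.real (Y ⁻¹' {y}) = 0
    · have : μ.real (E ∩ Y ⁻¹' {y}) = 0 :=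
        le_antisymm ((measureReal_mono inter_subset_right).trans h0.le) measureReal_nonneg
      simp [h0, this]
    · field_simp
  · simp [hy]

section CondEntropy

variable {X J : Type*} {mX : MeasurableSpace X} [Fintype J] {μ : Measure X}
  [IsProbabilityMeasure μ] {T : X → X} {β : X → J}

/-- The conditional entropy of the coding `β` given a sub-σ-algebra. -/
noncomputable def condEntAlg (μ : Measure X) (β : X → J) (m : MeasurableSpace X) : ℝ :=
  ∑ t, ∫ x, Real.negMulLog ((μ[(β ⁻¹' {t}).indicator 1 | m]) x) ∂μ

lemma condExp_indicator_mem_Icc (m : MeasurableSpace X) {E : Set X} (hE : MeasurableSet[mX] E) :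
    ∀ᵐ x ∂μ, (μ[E.indicator (1 : X → ℝ) | m]) x ∈ Icc (0 : ℝ) 1 := by
  by_cases hm : m ≤ mX
  · have hi : Integrable (E.indicator (1 : X → ℝ)) μ := (integrable_const (1 : ℝ)).indicator hE
    have h0 : 0 ≤ᵐ[μ] μ[E.indicator (1 : X → ℝ) | m] :=
      condExp_nonneg (Eventually.of_forall fun x => indicator_nonneg (fun _ _ => zero_le_one) x)
    have h1 : μ[E.indicator (1 : X → ℝ) | m] ≤ᵐ[μ] μ[fun _ => (1 : ℝ) | m] :=
      condExp_mono hi (integrable_const _)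
        (Eventually.of_forall fun x => indicator_le_self' (fun _ _ => zero_le_one) x)
    rw [condExp_const hm] at h1
    filter_upwards [h0, h1] with x ha hb using ⟨ha, hb⟩
  · rw [condExp_of_not_le hm]
    exact Eventually.of_forall fun x => by simp

lemma condEntAlg_comap {K : Type*} [Fintype K] (hβ : Measurable[_, ⊤] β) {Y : X → K}
    (hY : Measurable[_, ⊤] Y) :
    condEntAlg μ β (MeasurableSpace.comap Y ⊤) =
      ∑ p : J × K, Real.negMulLog (μ.real (β ⁻¹' {p.1} ∩ Y ⁻¹' {p.2})) -
        ∑ y, Real.negMulLog (μ.real (Y ⁻¹' {y})) := by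
  have hβS : ∀ S : Set J, MeasurableSet (β ⁻¹' S) := fun S => hβ trivial
  have h1 : ∀ t, ∫ x, Real.negMulLog
      ((μ[(β ⁻¹' {t}).indicator 1 | MeasurableSpace.comap Y ⊤]) x) ∂μ =
      ∑ y, μ.real (Y ⁻¹' {y}) *
        Real.negMulLog (μ.real (β ⁻¹' {t} ∩ Y ⁻¹' {y}) / μ.real (Y ⁻¹' {y})) := by
    intro t
    rw [← integral_comp_fintype hY fun y =>
      Real.negMulLog (μ.real (β ⁻¹' {t} ∩ Y ⁻¹' {y}) / μ.real (Y ⁻¹' {y}))]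
    refine integral_congr_ae ?_
    filter_upwards [condExp_indicator_comap_ae_eq (μ := μ) hY (hβS {t})] with x hx
    rw [← hx]
  have hsum : ∀ y, ∑ t, μ.real (β ⁻¹' {t} ∩ Y ⁻¹' {y}) = μ.real (Y ⁻¹' {y}) := by
    intro y
    have := integral_comp_fintype (ν := μ.restrict (Y ⁻¹' {y})) hβ (fun _ => (1 : ℝ))
    simp only [mul_one, integral_const, smul_eq_mul, measureReal_restrict_apply_univ] at this
    rw [this]
    exact Finset.sum_congr rfl fun t _ => (measureReal_restrict_apply (hβS _)).symm
  simp only [condEntAlg, h1]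
  rw [Finset.sum_comm, Fintype.sum_prod_type_right, ← Finset.sum_sub_distrib]
  refine Finset.sum_congr rfl fun y _ => ?_
  by_cases h0 : μ.real (Y ⁻¹' {y}) = 0
  · have : ∀ t, μ.real (β ⁻¹' {t} ∩ Y ⁻¹' {y}) = 0 := fun t =>
      le_antisymm ((measureReal_mono inter_subset_right).trans h0.le) measureReal_nonneg
    simp [h0, this]
  · have h2 : ∀ t, Real.negMulLog (μ.real (β ⁻¹' {t} ∩ Y ⁻¹' {y})) =
        μ.real (β ⁻¹' {t} ∩ Y ⁻¹' {y}) / μ.real (Y ⁻¹' {y}) *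
          Real.negMulLog (μ.real (Y ⁻¹' {y})) +
        μ.real (Y ⁻¹' {y}) *
          Real.negMulLog (μ.real (β ⁻¹' {t} ∩ Y ⁻¹' {y}) / μ.real (Y ⁻¹' {y})) := by
      intro t
      rw [← Real.negMulLog_mul]
      congr 1
      field_simp
    simp only [h2]
    rw [Finset.sum_add_distrib, ← Finset.sum_mul, ← Finset.sum_div, hsum, div_self h0]
    ring

/-- Increments of the entropies of iterated joins are conditional entropies given a finite piece
of the future. -/
lemma entH_dynJoin_succ_sub (hT : MeasurePreserving T μ μ) (hβ : Measurable[_, ⊤] β) (n : ℕ) :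
    entH μ (dynJoin T (fun t => β ⁻¹' {t}) (n + 1)) - entH μ (dynJoin T (fun t => β ⁻¹' {t}) n) =
      condEntAlg μ β (MeasurableSpace.comap (itin T β n ∘ T) ⊤) := by
  have hY : Measurable[_, ⊤] (itin T β n ∘ T) := by
    let : MeasurableSpace (Fin n → J) := ⊤
    exact (measurable_itin hT.measurable hβ n).comp hT.measurable
  rw [condEntAlg_comap hβ hY]
  congr 1
  · rw [entH, ← (Fin.consEquiv fun _ => J).sum_comp]
    refine Finset.sum_congr rfl fun p _ => ?_
    rw [dynJoin_fiber_eq]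
    change Real.negMulLog (μ.real _) = _
    congr 2
    ext x
    simp [itin, funext_iff, Fin.forall_fin_succ]
  · refine Finset.sum_congr rfl fun c _ => ?_
    rw [dynJoin_fiber_eq]
    change Real.negMulLog (μ.real _) = _
    congr 1
    rw [preimage_comp, measureReal_def, measureReal_def,
      hT.measure_preimage (measurable_itin hT.measurable hβ n trivial).nullMeasurableSet]

/-- The entropy rate equals the conditional entropy given the future. -/
lemma tendsto_entH_dynJoin_div (hT : MeasurePreserving T μ μ) (hβ : Measurable[_, ⊤] β) :
    Tendsto (fun n : ℕ => entH μ (dynJoin T (fun t => β ⁻¹' {t}) n) / n) atTop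
      (𝓝 (condEntAlg μ β (futAlg T β))) := by
  set H : ℕ → ℝ := fun n => entH μ (dynJoin T (fun t => β ⁻¹' {t}) n) with hH
  have hβS : ∀ S : Set J, MeasurableSet (β ⁻¹' S) := fun S => hβ trivial
  have hmono : Monotone fun n => MeasurableSpace.comap (itin T β n ∘ T) ⊤ := by
    refine monotone_nat_of_le_succ fun n => ?_
    have : itin T β n ∘ T = (fun c : Fin (n + 1) → J => c ∘ Fin.castSucc) ∘
        (itin T β (n + 1) ∘ T) := by ext x l; simp [itin]
    rw [this]
    exact comap_comp_top_le _ _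
  let ℱ : Filtration ℕ mX := ⟨fun n => MeasurableSpace.comap (itin T β n ∘ T) ⊤, hmono, fun n => by
    let : MeasurableSpace (Fin n → J) := ⊤
    exact ((measurable_itin hT.measurable hβ n).comp hT.measurable).comap_le⟩
  have hsup : ⨆ n, ℱ n = futAlg T β := futAlg_eq.symm
  have hlim : Tendsto (fun n => condEntAlg μ β (ℱ n)) atTop (𝓝 (condEntAlg μ β (futAlg T β))) := by
    refine tendsto_finsetSum _ fun t _ => ?_
    refine tendsto_integral_of_dominated_convergence (fun _ => 1) (fun n => ?_)
      (integrable_const _) (fun n => ?_) ?_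
    · exact Real.continuous_negMulLog.comp_aestronglyMeasurable
        (stronglyMeasurable_condExp.mono (ℱ.le n)).aestronglyMeasurable
    · filter_upwards [condExp_indicator_mem_Icc (μ := μ) (ℱ n) (hβS {t})] with x hx
      rw [Real.norm_of_nonneg (Real.negMulLog_nonneg hx.1 hx.2)]
      linarith [Real.negMulLog_le_one_sub_self hx.1, hx.1]
    · have := tendsto_ae_condExp (μ := μ) (ℱ := ℱ) ((β ⁻¹' {t}).indicator 1)
      rw [hsup] at this
      filter_upwards [this] with x hx
      exact (Real.continuous_negMulLog.tendsto _).comp hx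
  have hH0 : H 0 = 0 := by
    simp [hH, entH, dynJoin]
  have hHsum : ∀ n, H n = ∑ l ∈ Finset.range n, condEntAlg μ β (ℱ l) := by
    intro n
    have := Finset.sum_range_sub H n
    rw [hH0, sub_zero] at this
    rw [← this]
    exact Finset.sum_congr rfl fun l _ => entH_dynJoin_succ_sub hT hβ l
  refine hlim.cesaro.congr fun n => ?_
  rw [← hHsum, div_eq_inv_mul]

end CondEntropy

section Info

variable {X J : Type*} {mX : MeasurableSpace X} {μ : Measure X} {T : X → X} {β : X → J}

/-- The conditional probability of the symbol `t` given the future, clipped to `[exp (-M), 1]`. -/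
noncomputable def clipProb (μ : Measure X) (T : X → X) (β : X → J) (M : ℝ) (t : J) (x : X) : ℝ :=
  max (Real.exp (-M)) (min 1 ((μ[(β ⁻¹' {t}).indicator (1 : X → ℝ) | futAlg T β]) x))

/-- The truncated information function of `β` given the future. -/
noncomputable def infoFun (μ : Measure X) (T : X → X) (β : X → J) (M : ℝ) (x : X) : ℝ :=
  -Real.log (clipProb μ T β M (β x) x)

lemma clipProb_pos (M : ℝ) (t : J) (x : X) : 0 < clipProb μ T β M t x :=
  lt_max_of_lt_left (Real.exp_pos _)

lemma clipProb_le_one {M : ℝ} (hM : 0 ≤ M) (t : J) (x : X) : clipProb μ T β M t x ≤ 1 :=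
  max_le (Real.exp_le_one_iff.2 (neg_nonpos.2 hM)) (min_le_left _ _)

lemma stronglyMeasurable_clipProb (M : ℝ) (t : J) :
    StronglyMeasurable[futAlg T β] (clipProb μ T β M t) :=
  (by fun_prop : Continuous fun y : ℝ => max (Real.exp (-M)) (min 1 y)).comp_stronglyMeasurable
    stronglyMeasurable_condExp

lemma measurable_clipProb (M : ℝ) (t : J) :
    Measurable[futAlg T β] (clipProb μ T β M t) :=
  (stronglyMeasurable_clipProb M t).measurable

lemma neg_log_clipProb_mem_Icc {M : ℝ} (hM : 0 ≤ M) (t : J) (x : X) :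
    -Real.log (clipProb μ T β M t x) ∈ Icc 0 M := by
  refine ⟨neg_nonneg.2 (Real.log_nonpos (clipProb_pos M t x).le (clipProb_le_one hM t x)), ?_⟩
  have h : Real.exp (-M) ≤ clipProb μ T β M t x := le_max_left _ _
  have := Real.log_le_log (Real.exp_pos (-M)) h
  rw [Real.log_exp] at this
  linarith

lemma infoFun_mem_Icc {M : ℝ} (hM : 0 ≤ M) (x : X) : infoFun μ T β M x ∈ Icc 0 M :=
  neg_log_clipProb_mem_Icc hM _ x

lemma infoFun_eq_sum [Fintype J] (M : ℝ) (x : X) :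
    infoFun μ T β M x =
      ∑ t, (β ⁻¹' {t}).indicator 1 x * -Real.log (clipProb μ T β M t x) := by
  rw [Finset.sum_eq_single (β x)]
  · simp [infoFun]
  · intro t _ ht
    simp [ht.symm]
  · simp

lemma measurable_infoFun [Fintype J] (M : ℝ) : Measurable[itinAlg T β] (infoFun μ T β M) := by
  have : infoFun μ T β M = fun x =>
      ∑ t, (β ⁻¹' {t}).indicator 1 x * -Real.log (clipProb μ T β M t x) :=
    funext (infoFun_eq_sum M)
  rw [this]
  let := itinAlg T β
  refine Finset.measurable_sum _ fun t _ => Measurable.mul ?_ ?_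
  · refine measurable_one.indicator ?_
    exact comap_le_itinAlg _ ⟨{t}, trivial, rfl⟩
  · exact ((measurable_clipProb M t).mono futAlg_le_itinAlg le_rfl).log.neg

end Info

section OneStep

variable {X J : Type*} {mX : MeasurableSpace X} [Fintype J] {μ : Measure X}
  [IsProbabilityMeasure μ] {T : X → X} {β : X → J}

lemma integral_infoFun (hT : Measurable T) (hβ : Measurable[_, ⊤] β) {M : ℝ} (hM : 0 ≤ M) :
    ∫ x, infoFun μ T β M x ∂μ = ∑ t, ∫ x, (μ[(β ⁻¹' {t}).indicator 1 | futAlg T β]) x *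
      -Real.log (clipProb μ T β M t x) ∂μ := by
  have hle := futAlg_le hT hβ
  have hg : ∀ t, StronglyMeasurable[futAlg T β] fun x => -Real.log (clipProb μ T β M t x) :=
    fun t => (measurable_clipProb M t).log.neg.stronglyMeasurable
  have hi : ∀ t, Integrable ((β ⁻¹' {t}).indicator (1 : X → ℝ)) μ :=
    fun t => (integrable_const (1 : ℝ)).indicator (hβ trivial)
  have hb : ∀ t, Integrable ((β ⁻¹' {t}).indicator (1 : X → ℝ) *
      fun x => -Real.log (clipProb μ T β M t x)) μ := fun t =>
    (hi t).mul_bdd (c := M) ((hg t).mono hle).aestronglyMeasurable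
      (Eventually.of_forall fun x => by
        have := neg_log_clipProb_mem_Icc (μ := μ) (T := T) (β := β) hM t x
        rw [Real.norm_of_nonneg this.1]
        exact this.2)
  simp_rw [infoFun_eq_sum]
  refine (integral_finsetSum _ fun t _ => hb t).trans ?_
  refine Finset.sum_congr rfl fun t _ => ?_
  have h1 := condExp_mul_of_stronglyMeasurable_right (hg t) (hb t) (hi t)
  calc _ = ∫ x, (μ[(β ⁻¹' {t}).indicator (1 : X → ℝ) *
        fun x => -Real.log (clipProb μ T β M t x) | futAlg T β]) x ∂μ :=
        (integral_condExp hle).symm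
    _ = _ := integral_congr_ae h1

/-- The integral of the truncated information function approximates the conditional entropy. -/
lemma tendsto_integral_infoFun (hT : Measurable T) (hβ : Measurable[_, ⊤] β) :
    Tendsto (fun n : ℕ => ∫ x, infoFun μ T β n x ∂μ) atTop
      (𝓝 (condEntAlg μ β (futAlg T β))) := by
  have hle := futAlg_le hT hβ
  simp_rw [integral_infoFun hT hβ (Nat.cast_nonneg _)]
  refine tendsto_finsetSum _ fun t _ => ?_
  refine tendsto_integral_of_dominated_convergence (fun _ => 1) (fun n => ?_)
    (integrable_const _) (fun n => ?_) ?_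
  · exact ((stronglyMeasurable_condExp.mono hle).aestronglyMeasurable.mul
      (((measurable_clipProb _ t).log.neg.stronglyMeasurable.mono hle).aestronglyMeasurable))
  · filter_upwards [condExp_indicator_mem_Icc (μ := μ) (futAlg T β) (E := β ⁻¹' {t})
      (hβ trivial)] with x hx
    have h1 := neg_log_clipProb_mem_Icc (μ := μ) (T := T) (β := β) (Nat.cast_nonneg n) t x
    rw [Real.norm_of_nonneg (mul_nonneg hx.1 h1.1)]
    set p := (μ[(β ⁻¹' {t}).indicator (1 : X → ℝ) | futAlg T β]) x with hp
    rcases hx.1.eq_or_lt with h0 | h0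
    · rw [← h0, zero_mul]
      exact zero_le_one
    · have h2 : p ≤ clipProb μ T β n t x :=
        (le_min hx.2 le_rfl).trans (le_max_right _ _)
      have h3 := Real.log_le_log h0 h2
      have h4 := Real.negMulLog_le_one_sub_self hx.1
      have h5 : p * -Real.log (clipProb μ T β n t x) ≤ p * -Real.log p :=
        mul_le_mul_of_nonneg_left (neg_le_neg h3) hx.1
      rw [Real.negMulLog] at h4
      linarith
  · filter_upwards [condExp_indicator_mem_Icc (μ := μ) (futAlg T β) (E := β ⁻¹' {t})
      (hβ trivial)] with x hx
    refine tendsto_const_nhds.congr' ?_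
    rcases hx.1.eq_or_lt with h0 | h0
    · rw [← h0]
      simp
    · obtain ⟨N, hN⟩ := exists_nat_ge
        (-Real.log ((μ[(β ⁻¹' {t}).indicator (1 : X → ℝ) | futAlg T β]) x))
      filter_upwards [eventually_ge_atTop N] with n hn
      have h1 : Real.exp (-(n : ℝ)) ≤ (μ[(β ⁻¹' {t}).indicator (1 : X → ℝ) | futAlg T β]) x := by
        rw [← Real.le_log_iff_exp_le h0]
        have : (N : ℝ) ≤ n := by exact_mod_cast hn
        linarith
      have h2 : clipProb μ T β n t x = (μ[(β ⁻¹' {t}).indicator (1 : X → ℝ) | futAlg T β]) x := by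
        rw [clipProb, min_eq_right hx.2, max_eq_right h1]
      rw [h2, Real.negMulLog]
      ring

/-- Restricting to an event and integrating a function measurable for a sub-σ-algebra amounts to
weighting by the conditional probability. -/
lemma setLIntegral_eq_lintegral_condExp_mul {m : MeasurableSpace X} (hm : m ≤ mX) {E : Set X}
    (hE : MeasurableSet[mX] E) {F : X → ℝ≥0∞} (hF : Measurable[m] F) :
    ∫⁻ x in E, F x ∂μ =
      ∫⁻ x, ENNReal.ofReal ((μ[E.indicator (1 : X → ℝ) | m]) x) * F x ∂μ := by
  set P := μ[E.indicator (1 : X → ℝ) | m] with hP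
  have hPm : Measurable[mX] fun x => ENNReal.ofReal (P x) :=
    (stronglyMeasurable_condExp.measurable.mono hm le_rfl).ennreal_ofReal
  have hi : Integrable (E.indicator (1 : X → ℝ)) μ := (integrable_const (1 : ℝ)).indicator hE
  have key : (μ.restrict E).trim hm = (μ.withDensity fun x => ENNReal.ofReal (P x)).trim hm := by
    refine @Measure.ext _ m _ _ fun s hs => ?_
    rw [trim_measurableSet_eq hm hs, trim_measurableSet_eq hm hs, withDensity_apply _ (hm s hs),
      Measure.restrict_apply (hm s hs), ← ofReal_integral_eq_lintegral_ofReal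
        integrable_condExp.integrableOn, setIntegral_condExp hm hi hs,
      setIntegral_indicator hE]
    · simp
    · refine ae_restrict_of_ae ?_
      filter_upwards [condExp_indicator_mem_Icc (μ := μ) m hE] with x hx using hx.1
  rw [← lintegral_trim hm hF, key, lintegral_trim hm hF,
    lintegral_withDensity_eq_lintegral_mul _ hPm (hF.mono hm le_rfl)]
  rfl

/-- One-step estimate: the exponential of the information function is integrable against functions
of the future, uniformly in the truncation. -/
lemma lintegral_weight_exp_infoFun_mul_le (hT : Measurable T) (hβ : Measurable[_, ⊤] β) (M : ℝ)
    (w : J → ℝ≥0∞) {ψ : X → ℝ≥0∞} (hψ : Measurable[futAlg T β] ψ) :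
    ∫⁻ x, w (β x) * ENNReal.ofReal (Real.exp (infoFun μ T β M x)) * ψ x ∂μ ≤
      (∑ t, w t) * ∫⁻ x, ψ x ∂μ := by
  have hle := futAlg_le hT hβ
  have hE : ∀ t, MeasurableSet (β ⁻¹' {t}) := fun t => hβ trivial
  have hcl : ∀ t, Measurable[futAlg T β]
      fun x => ENNReal.ofReal ((clipProb μ T β M t x)⁻¹) * ψ x := fun t =>
    (measurable_clipProb M t).inv.ennreal_ofReal.mul hψ
  have h1 : ∀ x, w (β x) * ENNReal.ofReal (Real.exp (infoFun μ T β M x)) * ψ x =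
      ∑ t, w t * (β ⁻¹' {t}).indicator
        (fun x => ENNReal.ofReal ((clipProb μ T β M t x)⁻¹) * ψ x) x := by
    intro x
    rw [Finset.sum_eq_single (β x)]
    · simp [infoFun, Real.exp_neg, Real.exp_log (clipProb_pos M _ x), mul_assoc]
    · intro t _ ht
      simp [ht.symm]
    · simp
  simp_rw [h1]
  rw [lintegral_finsetSum, Finset.sum_mul]
  · refine Finset.sum_le_sum fun t _ => ?_
    rw [lintegral_const_mul _ (((hcl t).mono hle le_rfl).indicator (hE t)),
      lintegral_indicator (hE t), setLIntegral_eq_lintegral_condExp_mul hle (hE t) (hcl t)]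
    gcongr w t * ?_
    refine lintegral_mono_ae ?_
    filter_upwards [condExp_indicator_mem_Icc (μ := μ) (futAlg T β) (hE t)] with x hx
    rw [← mul_assoc, ← ENNReal.ofReal_mul hx.1]
    refine mul_le_of_le_one_left' (ENNReal.ofReal_le_one.2 ?_)
    rw [← div_eq_mul_inv]
    exact div_le_one_of_le₀ ((le_min hx.2 le_rfl).trans (le_max_right _ _))
      (clipProb_pos M t x).le
  · exact fun t _ => ((((hcl t).mono hle le_rfl).indicator (hE t)).const_mul _)

end OneStep

section Product

variable {X ι : Type*} [Preorder ι] {J : ι → Type*} {mX : MeasurableSpace X}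
  [∀ i, Fintype (J i)] {μ : Measure X} [IsProbabilityMeasure μ] {T : X → X}
  {β : ∀ i, X → J i}

/-- Product estimate along the orbit for a nested family of codings. -/
lemma lintegral_prod_weight_exp_infoFun_le (hT : MeasurePreserving T μ μ)
    (hβ : ∀ i, Measurable[_, ⊤] (β i))
    (hnest : ∀ i j, i ≤ j → ∃ g : J i → J j, β j = g ∘ β i) (M : ℝ) {C : ℝ≥0∞} (L : ℕ)
    (idx : ℕ → ι) (hidx : ∀ l l', l ≤ l' → l' < L → idx l ≤ idx l')
    (w : ∀ l, J (idx l) → ℝ≥0∞) (hw : ∀ l < L, ∑ t, w l t ≤ C) :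
    ∫⁻ x, ∏ l ∈ Finset.range L, (w l (β (idx l) (T^[l] x)) *
      ENNReal.ofReal (Real.exp (infoFun μ T (β (idx l)) M (T^[l] x)))) ∂μ ≤ C ^ L := by
  induction L generalizing idx with
  | zero => simp
  | succ L ih =>
    set Ψ : X → ℝ≥0∞ := fun x => ∏ l ∈ Finset.range L, (w (l + 1) (β (idx (l + 1)) (T^[l] x)) *
      ENNReal.ofReal (Real.exp (infoFun μ T (β (idx (l + 1))) M (T^[l] x)))) with hΨ
    have hΨm : Measurable[itinAlg T (β (idx 0))] Ψ := by
      let := itinAlg T (β (idx 0))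
      refine Finset.measurable_prod _ fun l hl => ?_
      obtain ⟨g, hg⟩ := hnest (idx 0) (idx (l + 1))
        (hidx 0 (l + 1) (Nat.zero_le _) (by simpa using hl))
      have hsub : itinAlg T (β (idx (l + 1))) ≤ itinAlg T (β (idx 0)) := by
        rw [hg]
        exact itinAlg_comp_le g
      have hit := measurable_itinAlg_iterate (T := T) (β := β (idx 0)) l
      have hc : Measurable[itinAlg T (β (idx 0))] fun x => w (l + 1) (β (idx (l + 1)) x) := by
        let : MeasurableSpace (J (idx (l + 1))) := ⊤
        have : Measurable (β (idx (l + 1))) :=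
          Measurable.of_comap_le (comap_le_itinAlg.trans hsub)
        exact (measurable_from_top (f := w (l + 1))).comp this
      have hi : Measurable[itinAlg T (β (idx 0))] fun x =>
          ENNReal.ofReal (Real.exp (infoFun μ T (β (idx (l + 1))) M x)) :=
        ((measurable_infoFun M).mono hsub le_rfl).exp.ennreal_ofReal
      exact (hc.mul hi).comp hit
    have hstep : ∀ x, ∏ l ∈ Finset.range (L + 1), (w l (β (idx l) (T^[l] x)) *
        ENNReal.ofReal (Real.exp (infoFun μ T (β (idx l)) M (T^[l] x)))) =
        w 0 (β (idx 0) x) * ENNReal.ofReal (Real.exp (infoFun μ T (β (idx 0)) M x)) *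
          Ψ (T x) := by
      intro x
      rw [Finset.prod_range_succ', mul_comm]
      rfl
    simp_rw [hstep]
    have hΨX : Measurable Ψ := hΨm.mono (itinAlg_le hT.measurable (hβ _)) le_rfl
    calc _ ≤ (∑ t, w 0 t) * ∫⁻ x, Ψ (T x) ∂μ :=
          lintegral_weight_exp_infoFun_mul_le hT.measurable (hβ _) M (w 0)
            (hΨm.comp measurable_futAlg_itinAlg)
      _ = (∑ t, w 0 t) * ∫⁻ x, Ψ x ∂μ := by rw [hT.lintegral_comp hΨX]
      _ ≤ C * C ^ L := by
          gcongr
          · exact hw 0 (Nat.succ_pos _)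
          · exact ih (fun l => idx (l + 1)) (fun l l' h h' => hidx _ _ (by lia) (by lia))
              (fun l => w (l + 1)) fun l hl => hw _ (by lia)
      _ = C ^ (L + 1) := (pow_succ' C L).symm

end Product

section Topology

/-- A finite Borel partition is approximated by an open cover with one additional small element,
off which the cover and the partition coincide. -/
lemma exists_isOpen_cover_of_isPart {Y : Type*} [PseudoEMetricSpace Y] [MeasurableSpace Y]
    [BorelSpace Y] {m : ℕ} {α : Fin m → Set Y} (hα : IsPart α) (ν : Measure Y) [IsFiniteMeasure ν]
    {δ : ℝ≥0∞} (hδ : δ ≠ 0) :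
    ∃ U : Fin (m + 1) → Set Y, (∀ l, IsOpen (U l)) ∧ ⋃ l, U l = univ ∧ ν (U 0) < δ ∧
      (∀ l l' : Fin m, l ≠ l' → Disjoint (U l.succ) (U l'.succ)) ∧
      ∀ y ∉ U 0, ∀ t v, y ∈ α t → y ∈ U v → v = t.succ := by
  obtain ⟨δ', hδ', hsum⟩ := ENNReal.exists_pos_sum_of_countable hδ (Fin m)
  have hK : ∀ l, ∃ K ⊆ α l, IsClosed K ∧ ν (α l \ K) < δ' l := fun l =>
    (hα.1 l).exists_isClosed_sdiff_lt (measure_ne_top _ _) (by simpa using (hδ' l).ne')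
  choose K hKα hKc hKν using hK
  have hdisj : ∀ l l', l ≠ l' → Disjoint (K l) (K l') := fun l l' h =>
    (hα.2.1 l l' h).mono (hKα l) (hKα l')
  set O : Fin m → Set Y := fun l => {y | ∀ j, j ≠ l → Metric.infEDist y (K l) <
    Metric.infEDist y (K j)} with hO
  have hOopen : ∀ l, IsOpen (O l) := fun l => by
    simp only [hO, ofPred_forall]
    exact isOpen_iInter_of_finite fun j => isOpen_iInter_of_finite fun _ =>
      isOpen_lt Metric.continuous_infEDist Metric.continuous_infEDist
  have hOdisj : ∀ l l', l ≠ l' → Disjoint (O l) (O l') := fun l l' h =>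
    Set.disjoint_left.2 fun y hy hy' => lt_asymm (hy l' h.symm) (hy' l h)
  have hKO : ∀ l, K l ⊆ O l := fun l y hy j hj => by
    rw [Metric.infEDist_zero_of_mem hy, Metric.infEDist_pos_iff_notMem_closure,
      (hKc j).closure_eq]
    exact Set.disjoint_left.1 (hdisj l j hj.symm) hy
  refine ⟨Fin.cons (⋃ l, K l)ᶜ O, ?_, ?_, ?_, ?_, ?_⟩
  · refine Fin.cases ?_ fun l => ?_
    · exact (isClosed_iUnion_of_finite hKc).isOpen_compl
    · exact hOopen l
  · refine eq_univ_of_forall fun y => mem_iUnion.2 ?_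
    by_cases hy : y ∈ ⋃ l, K l
    · obtain ⟨l, hl⟩ := mem_iUnion.1 hy
      exact ⟨l.succ, hKO l hl⟩
    · exact ⟨0, hy⟩
  · refine lt_of_le_of_lt ?_ hsum
    calc ν (⋃ l, K l)ᶜ ≤ ν (⋃ l, α l \ K l) := by
          refine measure_mono fun y hy => ?_
          obtain ⟨l, hl⟩ := mem_iUnion.1 (hα.2.2.symm ▸ mem_univ y : y ∈ ⋃ l, α l)
          exact mem_iUnion.2 ⟨l, hl, fun h => hy (mem_iUnion.2 ⟨l, h⟩)⟩
      _ ≤ ∑' l, ν (α l \ K l) := measure_iUnion_le _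
      _ ≤ ∑' l, (δ' l : ℝ≥0∞) := ENNReal.tsum_le_tsum fun l => (hKν l).le
  · exact hOdisj
  · intro y hy t v hyt hyv
    obtain ⟨l, hl⟩ : ∃ l, y ∈ K l := by simpa using hy
    have hlt : l = t := by
      by_contra h
      exact Set.disjoint_left.1 (hα.2.1 l t h) (hKα l hl) hyt
    subst hlt
    induction v using Fin.cases with
    | zero => exact absurd hyv hy
    | succ v =>
      by_contra h
      exact Set.disjoint_left.1 (hOdisj v l fun h' => h (h' ▸ rfl)) hyv (hKO l hl)

lemma symmDiff_subset_of_cover {Y : Type*} [MeasurableSpace Y] {m : ℕ} {α : Fin m → Set Y}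
    (hα : IsPart α) {U : Fin (m + 1) → Set Y} (hU : ⋃ l, U l = univ)
    (h : ∀ y ∉ U 0, ∀ t v, y ∈ α t → y ∈ U v → v = t.succ) (l : Fin m) :
    α l ∆ U l.succ ⊆ U 0 := by
  intro y hy
  by_contra h0
  rcases hy with ⟨hl, hn⟩ | ⟨hl, hn⟩
  · obtain ⟨v, hv⟩ := mem_iUnion.1 (hU.symm ▸ mem_univ y : y ∈ ⋃ l, U l)
    exact hn (h y h0 l v hl hv ▸ hv)
  · obtain ⟨t, ht⟩ := mem_iUnion.1 (hα.2.2.symm ▸ mem_univ y : y ∈ ⋃ l, α l)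
    exact hn (Fin.succ_injective _ (h y h0 t _ ht hl) ▸ ht)

lemma measure_compl_msupp {Y : Type*} [TopologicalSpace Y] [SecondCountableTopology Y]
    [MeasurableSpace Y] (ν : Measure Y) : ν (msupp ν)ᶜ = 0 := by
  refine measure_null_of_locally_null _ fun y hy => ?_
  obtain ⟨U, hU, hyU, h0⟩ : ∃ U, IsOpen U ∧ y ∈ U ∧ ν U = 0 := by
    simpa [msupp, pos_iff_ne_zero] using hy
  exact ⟨U, mem_nhdsWithin_of_mem_nhds (hU.mem_nhds hyU), h0⟩

end Topology

section Combinatorics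

lemma sum_ite_succ_le {m : ℕ} (v : Fin (m + 1)) {r : ℝ} (hr : 0 ≤ r) :
    ∑ t : Fin m, (if v = t.succ then 1 else r) ≤ Real.exp (r * m) := by
  have h1 : ∑ t : Fin m, (if v = t.succ then (1 : ℝ) else 0) ≤ 1 := by
    induction v using Fin.cases with
    | zero => simp [(Fin.succ_ne_zero _).symm]
    | succ v => simp
  calc ∑ t : Fin m, (if v = t.succ then 1 else r)
      ≤ ∑ t : Fin m, ((if v = t.succ then (1 : ℝ) else 0) + r) :=
        Finset.sum_le_sum fun t _ => by split_ifs <;> linarith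
    _ ≤ 1 + r * m := by
        rw [Finset.sum_add_distrib]
        simp only [Finset.sum_const, Finset.card_univ, Fintype.card_fin, nsmul_eq_mul]
        linarith
    _ ≤ Real.exp (r * m) := by linarith [Real.add_one_le_exp (r * m)]

lemma sum_prod_ite_succ_le {ι : Type*} [Fintype ι] [DecidableEq ι] {m : ι → ℕ}
    (v : ∀ j, Fin (m j + 1)) {r : ℝ} (hr : 0 ≤ r) :
    ∑ t : ∀ j, Fin (m j), ∏ j, (if v j = (t j).succ then 1 else r) ≤
      Real.exp (r * ∑ j, (m j : ℝ)) := by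
  rw [← Fintype.piFinset_univ, ← Finset.prod_univ_sum (fun _ => Finset.univ)
    (fun j (t : Fin (m j)) => if v j = t.succ then 1 else r), Finset.mul_sum, Real.exp_sum]
  exact Finset.prod_le_prod (fun j _ => Finset.sum_nonneg fun t _ => by split_ifs <;> positivity)
    fun j _ => sum_ite_succ_le (v j) hr

/-- Successive differences of a finite family, extended by zero at the end. -/
def diffNext {E : Type*} [AddGroup E] (g : Fin k → E) (j : Fin k) : E :=
  g j - if h : (j : ℕ) + 1 < k then g ⟨j + 1, h⟩ else 0

lemma sum_Ici_diffNext {E : Type*} [AddCommGroup E] (g : Fin k → E) (i : Fin k) :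
    ∑ j ∈ Finset.Ici i, diffNext g j = g i := by
  set G : ℕ → E := fun n => if h : n < k then g ⟨n, h⟩ else 0 with hG
  have h1 : ∀ j : Fin k, diffNext g j = G j - G (j + 1) := fun j => by simp [diffNext, hG]
  simp_rw [h1]
  refine (Finset.sum_map (Finset.Ici i) Fin.valEmbedding fun n => G n - G (n + 1)).symm.trans ?_
  rw [Fin.map_valEmbedding_Ici, Finset.sum_Ico_eq_sum_range]
  have h2 := Finset.sum_range_sub' (fun l => G (i + l)) (k - i)
  rw [Nat.add_sub_cancel' i.is_lt.le] at h2
  exact h2.trans (by simp [hG])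

lemma sum_cw_mul_diffNext (a : Fin k → ℝ) (g : Fin k → ℝ) :
    ∑ i, cw a i * diffNext g i = ∑ i, a i * g i := by
  simp_rw [cw, Finset.sum_mul, ← sum_Ici_diffNext g, Finset.mul_sum]
  exact Finset.sum_comm' fun i j => by simp

lemma cw_mono {a : Fin k → ℝ} (ha : ∀ i, 0 ≤ a i) : Monotone (cw a) := fun _ _ h =>
  Finset.sum_le_sum_of_subset_of_nonneg (Finset.Iic_subset_Iic.2 h) fun i _ _ => ha i

lemma cw_le_sum {a : Fin k → ℝ} (ha : ∀ i, 0 ≤ a i) (i : Fin k) : cw a i ≤ ∑ j, a j :=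
  Finset.sum_le_sum_of_subset_of_nonneg (Finset.subset_univ _) fun i _ _ => ha i

lemma cw_zero [NeZero k] (a : Fin k → ℝ) : cw a 0 = a 0 := by
  have : Finset.Iic (0 : Fin k) = {0} := by ext; simp
  simp [cw, this]

/-- For nondecreasing times `n j`, the set of `j` with `l < n j` is an upper set. -/
lemma exists_index_of_monotone [NeZero k] {n : Fin k → ℕ} (hn : Monotone n) :
    ∃ idx : ℕ → Fin k, ∀ l < Finset.univ.sup n, ∀ j, l < n j ↔ idx l ≤ j := by
  have : ∀ l, ∃ i : Fin k, l < Finset.univ.sup n → ∀ j, l < n j ↔ i ≤ j := by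
    intro l
    by_cases hl : l < Finset.univ.sup n
    · obtain ⟨j₀, -, hj₀⟩ := Finset.lt_sup_iff.1 hl
      obtain ⟨i, hi, hmin⟩ := wellFounded_lt.has_min {j | l < n j} ⟨j₀, hj₀⟩
      exact ⟨i, fun _ j => ⟨fun h => not_lt.1 (hmin j h), fun h => lt_of_lt_of_le hi (hn h)⟩⟩
    · exact ⟨0, fun h => absurd h hl⟩
  choose idx h using this
  exact ⟨idx, h⟩

lemma sum_sum_range_eq_sum_sum_Ici {n : Fin k → ℕ} {idx : ℕ → Fin k}
    (hidx : ∀ l < Finset.univ.sup n, ∀ j, l < n j ↔ idx l ≤ j) (h : Fin k → ℕ → ℝ) :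
    ∑ j, ∑ l ∈ Finset.range (n j), h j l =
      ∑ l ∈ Finset.range (Finset.univ.sup n), ∑ j ∈ Finset.Ici (idx l), h j l := by
  refine Finset.sum_comm' fun j l => ?_
  simp only [Finset.mem_univ, true_and, Finset.mem_range, Finset.mem_Ici]
  refine ⟨fun hl => ?_, fun hl => (hidx l hl.2 j).2 hl.1⟩
  have : l < Finset.univ.sup n := hl.trans_le (Finset.le_sup (Finset.mem_univ j))
  exact ⟨(hidx l this j).1 hl, this⟩

end Combinatorics

section Core

variable {X : Type*} {mX : MeasurableSpace X} {μ : Measure X} {T : X → X} {m : Fin k → ℕ}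
  {b : ∀ j, X → Fin (m j)} {V : ∀ j, Fin (m j + 1) → Set X}

/-- The joint coding by the partitions with index at least `i`. -/
def tailCode (b : ∀ j, X → Fin (m j)) (i : Fin k) (x : X) : ∀ j : {j // i ≤ j}, Fin (m j) :=
  fun j => b j x

lemma measurable_tailCode (hb : ∀ j t, MeasurableSet (b j ⁻¹' {t})) (i : Fin k) :
    Measurable[_, ⊤] (tailCode b i) := by
  let : MeasurableSpace (∀ j : {j // i ≤ j}, Fin (m j)) := ⊤
  refine measurable_to_countable' fun c => ?_
  have : tailCode b i ⁻¹' {c} = ⋂ j : {j // i ≤ j}, b j ⁻¹' {c j} := by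
    ext x
    simp [tailCode, funext_iff]
  rw [this]
  exact MeasurableSet.iInter fun j => hb j (c j)

lemma exists_tailCode_eq_comp {i j : Fin k} (h : i ≤ j) :
    ∃ g : (∀ l : {l // i ≤ l}, Fin (m l)) → ∀ l : {l // j ≤ l}, Fin (m l),
      tailCode b j = g ∘ tailCode b i :=
  ⟨fun c l => c ⟨l, h.trans l.2⟩, rfl⟩

/-- The weight comparing cover labels `v` with partition symbols `t`: each disagreement costs a
factor `exp (-K)`. -/
noncomputable def labelWeight (K : ℝ) (i : Fin k) (v : ∀ j, Fin (m j + 1))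
    (t : ∀ j : {j // i ≤ j}, Fin (m j)) : ℝ :=
  ∏ j : {j // i ≤ j}, if v j = (t j).succ then 1 else Real.exp (-K)

lemma labelWeight_nonneg (K : ℝ) (i : Fin k) (v : ∀ j, Fin (m j + 1))
    (t : ∀ j : {j // i ≤ j}, Fin (m j)) : 0 ≤ labelWeight K i v t :=
  Finset.prod_nonneg fun j _ => by split_ifs <;> positivity

lemma sum_labelWeight_le (K : ℝ) (i : Fin k) (v : ∀ j, Fin (m j + 1)) :
    ∑ t, ENNReal.ofReal (labelWeight K i v t) ≤
      ENNReal.ofReal (Real.exp (Real.exp (-K) * ∑ j, (m j : ℝ))) := by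
  rw [← ENNReal.ofReal_sum_of_nonneg fun t _ => labelWeight_nonneg K i v t]
  refine ENNReal.ofReal_le_ofReal ((sum_prod_ite_succ_le (fun j : {j // i ≤ j} => v j)
    (Real.exp_pos (-K)).le).trans (Real.exp_le_exp.2 ?_))
  gcongr
  rw [← Finset.sum_subtype (Finset.Ici i) (by simp) fun j => (m j : ℝ)]
  exact Finset.sum_le_sum_of_subset_of_nonneg (Finset.subset_univ _) fun _ _ _ => by positivity

lemma exp_sum_birkhoffSum_le_prod {K : ℝ} (hK : 0 ≤ K)
    (hV : ∀ j, ∀ x ∉ V j 0, ∀ v, x ∈ V j v → v = (b j x).succ) (g : Fin k → X → ℝ)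
    {n : Fin k → ℕ} {idx : ℕ → Fin k}
    (hidx : ∀ l < Finset.univ.sup n, ∀ j, l < n j ↔ idx l ≤ j) {v : ∀ j, ℕ → Fin (m j + 1)}
    {x : X} (hx : ∀ j, ∀ l < n j, T^[l] x ∈ V j (v j l)) :
    Real.exp (∑ j, birkhoffSum T
        (fun y => diffNext g j y - K * (V j 0).indicator 1 y) (n j) x) ≤
      ∏ l ∈ Finset.range (Finset.univ.sup n),
        labelWeight K (idx l) (fun j => v j l) (tailCode b (idx l) (T^[l] x)) *
          Real.exp (g (idx l) (T^[l] x)) := by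
  simp only [birkhoffSum]
  rw [sum_sum_range_eq_sum_sum_Ici hidx
    fun j l => diffNext g j (T^[l] x) - K * (V j 0).indicator 1 (T^[l] x), Real.exp_sum]
  refine Finset.prod_le_prod (fun _ _ => (Real.exp_pos _).le) fun l hl => ?_
  have hl := Finset.mem_range.1 hl
  set y := T^[l] x with hy
  have h1 : ∑ j ∈ Finset.Ici (idx l), diffNext g j y = g (idx l) y := by
    rw [← Finset.sum_apply, sum_Ici_diffNext]
  rw [Finset.sum_sub_distrib, h1, sub_eq_neg_add, Real.exp_add, ← Finset.sum_neg_distrib,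
    Finset.sum_subtype (p := fun j => idx l ≤ j) (Finset.Ici (idx l)) (by simp)
      (fun j => -(K * (V j 0).indicator 1 y)), Real.exp_sum]
  gcongr
  refine Finset.prod_le_prod (fun _ _ => (Real.exp_pos _).le) fun j _ => ?_
  by_cases h0 : y ∈ V j 0
  · simp only [indicator_of_mem h0, Pi.one_apply, mul_one]
    split_ifs
    · exact Real.exp_le_one_iff.2 (neg_nonpos.2 hK)
    · exact le_rfl
  · have h2 : v j l = (tailCode b (idx l) y j).succ :=
      hV j y h0 _ (hx j l ((hidx l hl j).2 j.2))
    simp [h0, h2]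

/-- The observables whose weighted Birkhoff sums bound the mass of an element of the cover. -/
noncomputable def coverObs [NeZero k] (μ : Measure X) (T : X → X) (b : ∀ j, X → Fin (m j))
    (V : ∀ j, Fin (m j + 1) → Set X) (M K : ℝ) (f : X → ℝ) (j : Fin k) (x : X) : ℝ :=
  diffNext (fun i => infoFun μ T (tailCode b i) M) j x - K * (V j 0).indicator 1 x +
    if j = 0 then f x else 0

lemma sum_birkhoffSum_coverObs [NeZero k] (M K : ℝ) (f : X → ℝ) (n : Fin k → ℕ) (x : X) :
    ∑ j, birkhoffSum T (coverObs μ T b V M K f j) (n j) x =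
      ∑ j, birkhoffSum T (fun y => diffNext (fun i => infoFun μ T (tailCode b i) M) j y -
        K * (V j 0).indicator 1 y) (n j) x + birkhoffSum T f (n 0) x := by
  have h : ∀ j, birkhoffSum T (coverObs μ T b V M K f j) (n j) x =
      birkhoffSum T (fun y => diffNext (fun i => infoFun μ T (tailCode b i) M) j y -
        K * (V j 0).indicator 1 y) (n j) x + if j = 0 then birkhoffSum T f (n 0) x else 0 := by
    intro j
    simp only [birkhoffSum, coverObs, Finset.sum_add_distrib]
    congr 1
    split_ifs with h0
    · rw [h0]
    · simp
  simp_rw [h, Finset.sum_add_distrib]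
  simp

variable [IsProbabilityMeasure μ]

/-- Mass bound for the part of an element of the joint cover on which the Birkhoff sums are
large. -/
lemma measure_inter_le_mul_pterm [NeZero k] (hT : MeasurePreserving T μ μ)
    (hb : ∀ j t, MeasurableSet (b j ⁻¹' {t})) {K : ℝ} (hK : 0 ≤ K)
    (hV : ∀ j, ∀ x ∉ V j 0, ∀ v, x ∈ V j v → v = (b j x).succ) (M : ℝ)
    {a : Fin k → ℝ} (ha0 : 0 < a 0) (ha : ∀ i, 0 ≤ a i) {f : X → ℝ} {F : ℝ}
    (hF : ∀ x, |f x| ≤ F) {G : Set X} {n : ℕ} {R s Q : ℝ}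
    (hG : ∀ x ∈ G, n * R ≤ ∑ j, birkhoffSum T
      (coverObs μ T b V M K (fun x => (1 / a 0) * f x) j) ⌈cw a j * (n : ℝ)⌉₊ x)
    (hQ : Q = Real.exp (-K) * ∑ j, (m j : ℝ)) (hs : s ≤ R - Q * ∑ j, a j)
    {A A' : Set X} (hA' : A' ∈ jointFiber T a (fun j => range (V j)) n) (hA : A ⊆ A') :
    μ (A ∩ G) ≤ ENNReal.ofReal (Real.exp Q) * pterm T f (a 0) s n A := by
  set N : Fin k → ℕ := fun j => ⌈cw a j * (n : ℝ)⌉₊ with hN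
  have hNmono : Monotone N := fun i j h =>
    Nat.ceil_mono (mul_le_mul_of_nonneg_right (cw_mono ha h) (Nat.cast_nonneg n))
  obtain ⟨idx, hidx⟩ := exists_index_of_monotone hNmono
  set L := Finset.univ.sup N with hL
  have hQ0 : 0 ≤ Q := by rw [hQ]; positivity
  have hS0 : 0 ≤ ∑ j, a j := Finset.sum_nonneg fun j _ => ha j
  have hLle : (L : ℝ) ≤ (∑ j, a j) * n + 1 := by
    have h1 : L ≤ ⌈(∑ j, a j) * n⌉₊ := Finset.sup_le fun j _ =>
      Nat.ceil_mono (mul_le_mul_of_nonneg_right (cw_le_sum ha j) (Nat.cast_nonneg n))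
    have h2 := Nat.ceil_lt_add_one (mul_nonneg hS0 (Nat.cast_nonneg n))
    have h3 : (L : ℝ) ≤ (⌈(∑ j, a j) * n⌉₊ : ℕ) := by exact_mod_cast h1
    linarith
  obtain ⟨W, hW, rfl⟩ := hA'
  have hW' : ∀ j l, ∃ v, l < N j → V j v = W j l := by
    intro j l
    by_cases hl : l < N j
    · obtain ⟨v, hv⟩ := hW j l hl
      exact ⟨v, fun _ => hv⟩
    · exact ⟨0, fun h => absurd h hl⟩
  choose v hv using hW'
  set g : Fin k → X → ℝ := fun i => infoFun μ T (tailCode b i) M with hg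
  have hgm : ∀ i, Measurable (g i) := fun i =>
    (measurable_infoFun M).mono (itinAlg_le hT.measurable (measurable_tailCode hb i)) le_rfl
  set Z : X → ℝ≥0∞ := fun x => ∏ l ∈ Finset.range L,
    (ENNReal.ofReal (labelWeight K (idx l) (fun j => v j l) (tailCode b (idx l) (T^[l] x))) *
      ENNReal.ofReal (Real.exp (g (idx l) (T^[l] x)))) with hZ
  have hZm : Measurable Z := by
    refine Finset.measurable_prod _ fun l _ => ?_
    have h1 : Measurable fun x => ENNReal.ofReal
        (labelWeight K (idx l) (fun j => v j l) (tailCode b (idx l) x)) := by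
      let : MeasurableSpace (∀ j : {j // idx l ≤ j}, Fin (m j)) := ⊤
      exact (measurable_from_top (f := fun t =>
        ENNReal.ofReal (labelWeight K (idx l) (fun j => v j l) t))).comp
        (measurable_tailCode hb (idx l))
    exact (h1.mul (hgm (idx l)).exp.ennreal_ofReal).comp (hT.measurable.iterate l)
  have hZint : ∫⁻ x, Z x ∂μ ≤ ENNReal.ofReal (Real.exp Q) ^ L := by
    refine lintegral_prod_weight_exp_infoFun_le (β := tailCode b) hT
      (fun i => measurable_tailCode hb i) (fun i j h => exists_tailCode_eq_comp h) M L idx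
      (fun l l' h h' => ?_) (fun l t => ENNReal.ofReal (labelWeight K (idx l) (fun j => v j l) t))
      fun l _ => hQ ▸ sum_labelWeight_le K (idx l) fun j => v j l
    exact (hidx l (h.trans_lt h') _).1 (h.trans_lt ((hidx l' h' _).2 le_rfl))
  set σ := (1 / a 0) * sSup (birk T f ⌈a 0 * (n : ℝ)⌉₊ '' A) with hσ
  have hbdd : BddAbove (birk T f ⌈a 0 * (n : ℝ)⌉₊ '' A) := by
    refine ⟨⌈a 0 * (n : ℝ)⌉₊ * F, ?_⟩
    rintro _ ⟨x, -, rfl⟩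
    calc birk T f ⌈a 0 * (n : ℝ)⌉₊ x ≤ ∑ l ∈ Finset.range ⌈a 0 * (n : ℝ)⌉₊, F :=
          Finset.sum_le_sum fun l _ => (le_abs_self _).trans (hF _)
      _ = _ := by simp
  have hlow : ∀ x ∈ A ∩ G, ENNReal.ofReal (Real.exp (n * R - σ)) ≤ Z x := by
    rintro x ⟨hxA, hxG⟩
    have hx : ∀ j, ∀ l < N j, T^[l] x ∈ V j (v j l) := by
      intro j l hl
      have := hA hxA
      simp only [mem_iInter, Finset.mem_range, mem_preimage] at this
      rw [hv j l hl]
      exact this j l hl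
    have h1 := exp_sum_birkhoffSum_le_prod hK hV g hidx hx
    have h2 := hG x hxG
    rw [sum_birkhoffSum_coverObs] at h2
    have h3 : birkhoffSum T (fun x => (1 / a 0) * f x) ⌈cw a 0 * (n : ℝ)⌉₊ x ≤ σ := by
      rw [cw_zero, hσ]
      simp only [birkhoffSum]
      rw [← Finset.mul_sum]
      gcongr
      exact le_csSup hbdd ⟨x, hxA, rfl⟩
    calc ENNReal.ofReal (Real.exp (n * R - σ)) ≤ ENNReal.ofReal _ :=
          ENNReal.ofReal_le_ofReal ((Real.exp_le_exp.2 (by linarith)).trans h1)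
      _ = Z x := by
          rw [ENNReal.ofReal_prod_of_nonneg fun l _ =>
            mul_nonneg (labelWeight_nonneg _ _ _ _) (Real.exp_pos _).le]
          exact Finset.prod_congr rfl fun l _ => ENNReal.ofReal_mul (labelWeight_nonneg _ _ _ _)
  have hmarkov : ENNReal.ofReal (Real.exp (n * R - σ)) * μ (A ∩ G) ≤
      ENNReal.ofReal (Real.exp (Q * L)) := by
    calc _ ≤ ENNReal.ofReal (Real.exp (n * R - σ)) *
          μ {x | ENNReal.ofReal (Real.exp (n * R - σ)) ≤ Z x} := by
          gcongr
          exact hlow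
      _ ≤ ∫⁻ x, Z x ∂μ := mul_meas_ge_le_lintegral hZm _
      _ ≤ _ := hZint
      _ = _ := by rw [← ENNReal.ofReal_pow (Real.exp_pos _).le, ← Real.exp_nat_mul, mul_comm]
  have hexp : μ (A ∩ G) ≤ ENNReal.ofReal (Real.exp (Q * L - (n * R - σ))) := by
    rw [Real.exp_sub, ENNReal.ofReal_div_of_pos (Real.exp_pos _),
      ENNReal.le_div_iff_mul_le (by simp [Real.exp_pos]) (by simp), mul_comm]
    exact hmarkov
  refine hexp.trans ?_
  rw [pterm, ← ENNReal.ofReal_mul (Real.exp_pos _).le, ← Real.exp_add]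
  refine ENNReal.ofReal_le_ofReal (Real.exp_le_exp.2 ?_)
  have h1 := mul_le_mul_of_nonneg_left hLle hQ0
  have h2 := mul_le_mul_of_nonneg_right hs (Nat.cast_nonneg (α := ℝ) n)
  rw [← hσ]
  linarith

end Core

section Positivity

variable {X : Type*} {mX : MeasurableSpace X} {μ : Measure X} {T : X → X}
  {m : Fin k → ℕ} {b : ∀ j, X → Fin (m j)} {V : ∀ j, Fin (m j + 1) → Set X}

lemma diffNext_apply (g : Fin k → X → ℝ) (j : Fin k) (x : X) :
    diffNext g j x = diffNext (fun i => g i x) j := by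
  by_cases h : (j : ℕ) + 1 < k <;> simp [diffNext, h]

lemma abs_diffNext_le {g : Fin k → ℝ} {M : ℝ} (hg : ∀ i, g i ∈ Icc 0 M) (j : Fin k) :
    |diffNext g j| ≤ M := by
  unfold diffNext
  split_ifs with h
  · exact abs_sub_le_of_nonneg_of_le (hg _).1 (hg _).2 (hg _).1 (hg _).2
  · rw [sub_zero, abs_of_nonneg (hg _).1]
    exact (hg _).2

lemma measurable_diffNext {g : Fin k → X → ℝ} (hg : ∀ i, Measurable (g i)) (j : Fin k) :
    Measurable (diffNext g j) := by
  unfold diffNext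
  split_ifs
  · exact (hg _).sub (hg _)
  · exact (hg _).sub measurable_const

lemma integral_diffNext {g : Fin k → X → ℝ} (hg : ∀ i, Integrable (g i) μ) (j : Fin k) :
    ∫ x, diffNext g j x ∂μ = diffNext (fun i => ∫ x, g i x ∂μ) j := by
  unfold diffNext
  split_ifs
  · exact integral_sub (hg _) (hg _)
  · simp

variable [NeZero k] [IsProbabilityMeasure μ]

lemma sum_cw_mul_integral_coverObs (hT : Measurable T) (hb : ∀ j t, MeasurableSet (b j ⁻¹' {t}))
    (hVm : ∀ j, MeasurableSet (V j 0)) {M : ℝ} (hM : 0 ≤ M) (K : ℝ) (a : Fin k → ℝ)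
    {f : X → ℝ} (hf : Integrable f μ) :
    ∑ j, cw a j * ∫ x, coverObs μ T b V M K f j x ∂μ =
      ∑ i, a i * ∫ x, infoFun μ T (tailCode b i) M x ∂μ -
        K * ∑ j, cw a j * μ.real (V j 0) + a 0 * ∫ x, f x ∂μ := by
  set g : Fin k → X → ℝ := fun i => infoFun μ T (tailCode b i) M with hg
  have hgm : ∀ i, Measurable (g i) := fun i =>
    (measurable_infoFun M).mono (itinAlg_le hT (measurable_tailCode hb i)) le_rfl
  have hgi : ∀ i, Integrable (g i) μ := fun i =>
    Integrable.of_bound (hgm i).aestronglyMeasurable M (Eventually.of_forall fun x => by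
      rw [Real.norm_of_nonneg (infoFun_mem_Icc hM x).1]
      exact (infoFun_mem_Icc hM x).2)
  have hDi : ∀ j, Integrable (diffNext g j) μ := fun j => by
    refine Integrable.of_bound (measurable_diffNext hgm j).aestronglyMeasurable M
      (Eventually.of_forall fun x => ?_)
    rw [diffNext_apply]
    exact abs_diffNext_le (fun i => infoFun_mem_Icc hM x) j
  have hVi : ∀ j, Integrable (fun x => K * (V j 0).indicator (1 : X → ℝ) x) μ := fun j =>
    ((integrable_const (1 : ℝ)).indicator (hVm j)).const_mul K
  have hfi : ∀ j : Fin k, Integrable (fun x => if j = 0 then f x else 0) μ := fun j => by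
    split_ifs
    · exact hf
    · exact integrable_zero _ _ _
  have h1 : ∀ j, ∫ x, coverObs μ T b V M K f j x ∂μ =
      diffNext (fun i => ∫ x, g i x ∂μ) j - K * μ.real (V j 0) +
        if j = 0 then ∫ x, f x ∂μ else 0 := by
    intro j
    refine (integral_add ((hDi j).sub (hVi j)) (hfi j)).trans
      (congrArg₂ (· + ·) ((integral_sub (hDi j) (hVi j)).trans ?_) ?_)
    · rw [integral_diffNext hgi, integral_const_mul, integral_indicator_one (hVm j)]
    · split_ifs <;> simp
  simp_rw [h1, mul_add, mul_sub, Finset.sum_add_distrib, Finset.sum_sub_distrib,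
    sum_cw_mul_diffNext, Finset.mul_sum]
  congr 1
  · congr 1
    exact Finset.sum_congr rfl fun j _ => by ring
  · simp [cw_zero]

lemma lamLoc_ne_zero (hT : MeasurePreserving T μ μ) (hb : ∀ j t, MeasurableSet (b j ⁻¹' {t}))
    (hVm : ∀ j, MeasurableSet (V j 0)) {K : ℝ} (hK : 0 ≤ K)
    (hV : ∀ j, ∀ x ∉ V j 0, ∀ v, x ∈ V j v → v = (b j x).succ) {M : ℝ} (hM : 0 ≤ M)
    {a : Fin k → ℝ} (ha0 : 0 < a 0) (ha : ∀ i, 0 ≤ a i) {f : X → ℝ} (hf : Measurable f) {F : ℝ}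
    (hF : ∀ x, |f x| ≤ F) {Z : Set X} (hZ : μ Zᶜ = 0) {s η Q : ℝ} (hη : 0 < η)
    (hQ : Q = Real.exp (-K) * ∑ j, (m j : ℝ))
    (hs : s ≤ ∑ i, a i * ∫ x, infoFun μ T (tailCode b i) M x ∂μ -
      K * ∑ j, cw a j * μ.real (V j 0) + ∫ x, f x ∂μ - η - Q * ∑ j, a j) :
    lamLoc T a (fun j => range (V j)) f s Z ≠ 0 := by
  have hcw : ∀ i, 0 < cw a i := fun i =>
    ha0.trans_le ((cw_zero a).symm.le.trans (cw_mono ha (Fin.zero_le i)))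
  set f₀ : X → ℝ := fun x => (1 / a 0) * f x with hf₀
  have hfi : Integrable f μ := Integrable.of_bound hf.aestronglyMeasurable F
    (Eventually.of_forall hF)
  have hφm : ∀ j, Measurable (coverObs μ T b V M K f₀ j) := fun j => by
    unfold coverObs
    refine ((measurable_diffNext (fun i => (measurable_infoFun M).mono (itinAlg_le hT.measurable
      (measurable_tailCode hb i)) le_rfl) j).sub
        ((measurable_one.indicator (hVm j)).const_mul K)).add ?_
    split_ifs
    · exact hf.const_mul _
    · exact measurable_const
  have hφb : ∀ j x, |coverObs μ T b V M K f₀ j x| ≤ M + K + (1 / a 0) * F := fun j x => by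
    have h1 : |diffNext (fun i => infoFun μ T (tailCode b i) M) j x| ≤ M := by
      rw [diffNext_apply]
      exact abs_diffNext_le (fun i => infoFun_mem_Icc hM x) j
    have h2 : |K * (V j 0).indicator 1 x| ≤ K := by
      by_cases h : x ∈ V j 0 <;> simp [h, abs_of_nonneg hK, hK]
    have h3 : |(if j = 0 then f₀ x else 0)| ≤ (1 / a 0) * F := by
      have h4 : |f₀ x| ≤ (1 / a 0) * F := by
        rw [hf₀, abs_mul, abs_of_pos (by positivity : 0 < 1 / a 0)]
        exact mul_le_mul_of_nonneg_left (hF x) (by positivity)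
      split_ifs
      · exact h4
      · simpa using (abs_nonneg _).trans h4
    exact (abs_add_le _ _).trans (add_le_add ((abs_sub _ _).trans (add_le_add h1 h2)) h3)
  obtain ⟨N, G, hG0, hG⟩ := exists_pos_measure_birkhoffSum_ge hT hφm hφb hcw hη
  have hR := sum_cw_mul_integral_coverObs (μ := μ) hT.measurable hb hVm hM K a
    (hfi.const_mul (1 / a 0))
  rw [integral_const_mul, ← mul_assoc, mul_one_div_cancel ha0.ne', one_mul] at hR
  have hbound : ∀ n, N ≤ n → ∀ A : Set X,
      (∃ A' ∈ jointFiber T a (fun j => range (V j)) n, A ⊆ A') →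
      μ (A ∩ G) ≤ ENNReal.ofReal (Real.exp Q) * pterm T f (a 0) s n A := by
    rintro n hn A ⟨A', hA', hA⟩
    refine measure_inter_le_mul_pterm hT hb hK hV M ha0 ha hF (fun x hx => hG x hx n hn) hQ ?_
      hA' hA
    rw [hR]
    exact hs
  have hlow : μ G ≤ ENNReal.ofReal (Real.exp Q) *
      lamLocN T a (fun j => range (V j)) f s N Z := by
    simp only [lamLocN, ENNReal.mul_iInf_of_ne (a := ENNReal.ofReal (Real.exp Q))
      (by simp [Real.exp_pos]) ENNReal.ofReal_ne_top]
    refine le_iInf fun D => le_iInf fun hD => le_iInf fun hDA => le_iInf fun hDZ => ?_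
    have := hD.to_subtype
    calc μ G ≤ μ ((⋃ p : D, p.1.2 ∩ G) ∪ Zᶜ) := by
          refine measure_mono fun x hx => ?_
          by_cases hxZ : x ∈ Z
          · obtain ⟨p, hp, hxp⟩ := mem_iUnion₂.1 (hDZ hxZ)
            exact Or.inl (mem_iUnion.2 ⟨⟨p, hp⟩, hxp, hx⟩)
          · exact Or.inr hxZ
      _ ≤ μ (⋃ p : D, p.1.2 ∩ G) := (measure_union_le _ _).trans (by rw [hZ, add_zero])
      _ ≤ ∑' p : D, μ (p.1.2 ∩ G) := measure_iUnion_le _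
      _ ≤ ∑' p : D, ENNReal.ofReal (Real.exp Q) * pterm T f (a 0) s p.1.1 p.1.2 :=
          ENNReal.tsum_le_tsum fun p => hbound _ (hDA p p.2).1 _ (hDA p p.2).2.2
      _ = _ := ENNReal.tsum_mul_left
  intro h0
  have h1 : lamLocN T a (fun j => range (V j)) f s N Z = 0 :=
    le_antisymm ((le_iSup (fun N => lamLocN T a (fun j => range (V j)) f s N Z) N).trans h0.le)
      zero_le
  rw [h1, mul_zero] at hlow
  exact hG0.not_ge hlow

end Positivity

lemma ereal_coe_sum {ι : Type*} (s : Finset ι) (u : ι → ℝ) :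
    ((∑ i ∈ s, u i : ℝ) : EReal) = ∑ i ∈ s, (u i : EReal) :=
  map_sum (⟨⟨Real.toEReal, EReal.coe_zero⟩, EReal.coe_add⟩ : ℝ →+ EReal) u s

/-- (local lower bound) Given finite Borel partitions `α_i` of `X_i`,
`μ ∈ M(X_1,T_1)` and `ε > 0`, there exist open covers `𝒰_i = {U_0^i, …, U_{m_i}^i}` of `X_i`
with `|𝒰_i| = |α_i| + 1`, `U_1^i,…,U_{m_i}^i` pairwise disjoint,
`(τ_{i-1}μ)(U_0^i) < ε`, `(τ_{i-1}μ)(A_l^i Δ U_l^i) < ε`, and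
`P^𝐚(T₁, supp μ, {𝒰_i}, f) ≥ ∑_i a_i h_μ(T₁, ⋁_{j=i}^k τ_{j-1}^{-1}α_j) + ∫ f dμ − ε`. -/
theorem local_lower_bound
    {k : ℕ} [NeZero k]
    (X : Fin k → Type) [∀ i, MetricSpace (X i)] [∀ i, CompactSpace (X i)]
    [∀ i, MeasurableSpace (X i)] [∀ i, BorelSpace (X i)]
    (T : ∀ i, X i → X i) (hT : ∀ i, Continuous (T i))
    (τ : ∀ i, X 0 → X i) (hτ0 : τ 0 = id)
    (hτc : ∀ i, Continuous (τ i)) (hτs : ∀ i, Function.Surjective (τ i))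
    (hτe : ∀ i, τ i ∘ T 0 = T i ∘ τ i)
    (hchain : ∀ i j : Fin k, i ≤ j → ∃ p : X i → X j,
        Continuous p ∧ p ∘ T i = T j ∘ p ∧ p ∘ τ i = τ j)
    (a : Fin k → ℝ) (ha1 : 0 < a 0) (ha : ∀ i, 0 ≤ a i)
    (m : Fin k → ℕ) (α : ∀ i, Fin (m i) → Set (X i)) (hα : ∀ i, IsPart (α i))
    (μ : Measure (X 0)) [IsProbabilityMeasure μ] (hμ : μ.map (T 0) = μ)
    (f : X 0 → ℝ) (hf : Continuous f) (ε : ℝ) (hε : 0 < ε) :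
    ∃ U : ∀ i, Fin (m i + 1) → Set (X i),
      (∀ i l, IsOpen (U i l)) ∧ (∀ i, (⋃ l, U i l) = Set.univ) ∧
      (∀ i, (μ.map (τ i)) (U i 0) < ENNReal.ofReal ε) ∧
      (∀ i (l : Fin (m i)), (μ.map (τ i)) (α i l ∆ U i l.succ) < ENNReal.ofReal ε) ∧
      (∀ i (l l' : Fin (m i)), l ≠ l' → Disjoint (U i l.succ) (U i l'.succ)) ∧
      ((∑ i : Fin k, ((a i : ℝ) : EReal) *
            hPart μ (T 0) (partJoinFrom (fun j t => τ j ⁻¹' α j t) i))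
          + ((∫ x, f x ∂μ : ℝ) : EReal) - ((ε : ℝ) : EReal)
        ≤ PLoc (T 0) a (fun i => pullCov (τ i) (Set.range (U i))) (msupp μ) f) := by
  classical
  have hT0 : MeasurePreserving (T 0) μ μ := ⟨(hT 0).measurable, hμ⟩
  have hcode : ∀ j x, ∃ t, τ j x ∈ α j t := fun j x =>
    mem_iUnion.1 ((hα j).2.2.symm ▸ mem_univ (τ j x) : τ j x ∈ ⋃ t, α j t)
  choose b hbα using hcode
  have hbfib : ∀ j t, b j ⁻¹' {t} = τ j ⁻¹' α j t := by
    intro j t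
    ext x
    refine ⟨fun h => (h : b j x = t) ▸ hbα j x, fun h => ?_⟩
    by_contra hne
    exact Set.disjoint_left.1 ((hα j).2.1 _ _ hne) (hbα j x) h
  have hb : ∀ j t, MeasurableSet (b j ⁻¹' {t}) := fun j t =>
    hbfib j t ▸ (hτc j).measurable ((hα j).1 t)
  set h : Fin k → ℝ := fun i => condEntAlg μ (tailCode b i) (futAlg (T 0) (tailCode b i))
  have hpart : ∀ i, hPart μ (T 0) (partJoinFrom (fun j t => τ j ⁻¹' α j t) i) = (h i : EReal) := by
    intro i
    have h1 : partJoinFrom (fun j t => τ j ⁻¹' α j t) i = fun c => tailCode b i ⁻¹' {c} := by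
      funext c
      ext x
      simp only [partJoinFrom, ← hbfib]
      simp [tailCode, funext_iff]
    rw [h1]
    exact (EReal.tendsto_coe.2
      (tendsto_entH_dynJoin_div hT0 (measurable_tailCode hb i))).liminf_eq
  obtain ⟨F, hF⟩ := isCompact_univ.exists_bound_of_continuousOn hf.continuousOn
  set S := ∑ j, a j
  set m₀ := ∑ j, (m j : ℝ)
  set C := ∑ j, cw a j with hC
  have hS0 : 0 ≤ S := Finset.sum_nonneg fun j _ => ha j
  have hm0 : 0 ≤ m₀ := Finset.sum_nonneg fun j _ => Nat.cast_nonneg _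
  have hcw : ∀ j, 0 ≤ cw a j := fun j => Finset.sum_nonneg fun j _ => ha j
  have hC0 : 0 ≤ C := Finset.sum_nonneg fun j _ => hcw j
  obtain ⟨M, hM⟩ : ∃ M : ℕ, ∑ i, a i * h i - ε / 5 <
      ∑ i, a i * ∫ x, infoFun μ (T 0) (tailCode b i) M x ∂μ := by
    have h1 : Tendsto (fun n : ℕ => ∑ i, a i * ∫ x, infoFun μ (T 0) (tailCode b i) n x ∂μ) atTop
        (𝓝 (∑ i, a i * h i)) := tendsto_finsetSum _ fun i _ =>
      (tendsto_integral_infoFun hT0.measurable (measurable_tailCode hb i)).const_mul (a i)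
    exact (h1.eventually_const_lt (by linarith)).exists
  set K := 5 * (S * m₀) / ε with hKdef
  have hK : 0 ≤ K := by positivity
  have hQ : Real.exp (-K) * m₀ * S ≤ ε / 5 := by
    have h1 : Real.exp (-K) * K ≤ 1 := by
      rw [Real.exp_neg, inv_mul_le_one₀ (Real.exp_pos _)]
      linarith [Real.add_one_le_exp K]
    calc Real.exp (-K) * m₀ * S = Real.exp (-K) * K * (ε / 5) := by
          rw [hKdef]
          field_simp
      _ ≤ 1 * (ε / 5) := by gcongr
      _ = ε / 5 := one_mul _
  set δ := min ε (ε / (5 * ((K + 1) * (C + 1)))) with hδ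
  have hδ0 : 0 < δ := by positivity
  have hKC : K * (C * δ) ≤ ε / 5 := by
    calc K * (C * δ) ≤ (K + 1) * ((C + 1) * (ε / (5 * ((K + 1) * (C + 1))))) := by
          gcongr
          · linarith
          · linarith
          · exact min_le_right _ _
      _ = ε / 5 := by field_simp
  have hU := fun i => exists_isOpen_cover_of_isPart (hα i) (μ.map (τ i))
    (ENNReal.ofReal_pos.2 hδ0).ne'
  choose U hUo hUc hU0 hUd hUα using hU
  have hδε : ENNReal.ofReal δ ≤ ENNReal.ofReal ε := ENNReal.ofReal_le_ofReal (min_le_left _ _)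
  refine ⟨U, hUo, hUc, fun i => (hU0 i).trans_le hδε, fun i l =>
    (measure_mono (symmDiff_subset_of_cover (hα i) (hUc i) (hUα i) l)).trans_lt
      ((hU0 i).trans_le hδε), hUd, ?_⟩
  set V : ∀ j, Fin (m j + 1) → Set (X 0) := fun j l => τ j ⁻¹' U j l
  have hVm : ∀ j, MeasurableSet (V j 0) := fun j => (hτc j).measurable (hUo j 0).measurableSet
  have hVδ : ∀ j, μ.real (V j 0) ≤ δ := fun j => by
    have h1 := hU0 j
    rw [Measure.map_apply (hτc j).measurable (hUo j 0).measurableSet] at h1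
    exact ENNReal.toReal_le_of_le_ofReal hδ0.le h1.le
  have hVsum : K * ∑ j, cw a j * μ.real (V j 0) ≤ ε / 5 := by
    refine le_trans ?_ hKC
    rw [hC, Finset.sum_mul]
    gcongr with j
    · exact hcw j
    · exact hVδ j
  have hcov : (fun i => pullCov (τ i) (Set.range (U i))) = fun i => range (V i) := by
    funext i
    exact (range_comp _ _).symm
  have htarget : (∑ i : Fin k, ((a i : ℝ) : EReal) *
      hPart μ (T 0) (partJoinFrom (fun j t => τ j ⁻¹' α j t) i))
        + ((∫ x, f x ∂μ : ℝ) : EReal) - ((ε : ℝ) : EReal) =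
      ((∑ i, a i * h i + ∫ x, f x ∂μ - ε : ℝ) : EReal) := by
    simp_rw [hpart, ← EReal.coe_mul, ← ereal_coe_sum, ← EReal.coe_add, ← EReal.coe_sub]
  rw [htarget, hcov, PLoc]
  refine le_sInf ?_
  rintro _ ⟨s, hs, rfl⟩
  rw [EReal.coe_le_coe_iff]
  by_contra! hlt
  refine lamLoc_ne_zero (s := s) hT0 hb hVm hK (fun j x hx v hv => hUα j _ hx _ v (hbα j x) hv)
    (Nat.cast_nonneg M) ha1 ha hf.measurable (fun x => hF x (mem_univ x))
    (measure_compl_msupp μ) (η := ε / 5) (by positivity) rfl ?_ hs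
  linarith

end WTP
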